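/- arXiv:2002.08580 — 8 statements merged into one kernel-verified Lean document; each statement's English description precedes it below -/
import Mathlib

section
/- Let U be a linear subspace of ℝ^t with dim(U) = ℓ, let 𝒲 be a finite collection of linear subspaces of ℝ^t, and let ℓ' ≤ ℓ be a natural number such that dim(U ∩ W) ≤ ℓ' for every W ∈ 𝒲. Then there exists a linear subspace U' of U with dim(U') = ℓ − ℓ' such that dim(U' ∩ W) = 0 for every W ∈ 𝒲. -/
/-- A subspace over an infinite field that is contained in no member of a finite family of
subspaces has an element lying in none of them. -/
theorem exists_mem_forall_notMem_of_not_le {K V : Type*} [Field K] [Infinite K]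
    [AddCommGroup V] [Module K V] (U : Submodule K V) (s : Finset (Submodule K V))
    (hs : ∀ P ∈ s, ¬ U ≤ P) : ∃ v ∈ U, ∀ P ∈ s, v ∉ P := by
  by_contra! hcon
  have hcovers : ⋃ P : s, ((P : Submodule K V).comap U.subtype : Set U) = Set.univ := by
    refine Set.eq_univ_of_forall fun v => ?_
    obtain ⟨P, hP, hv⟩ := hcon v v.2
    exact Set.mem_iUnion.2 ⟨⟨P, hP⟩, hv⟩
  obtain ⟨P, hP⟩ := Subspace.exists_eq_top_of_iUnion_eq_univ hcovers
  exact hs P P.2 (Submodule.comap_subtype_eq_top.1 hP)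

/-- If every member of a finite family of subspaces meets `U` in dimension at most `m`, then
`U` has subspaces of every dimension `d ≤ dim U - m` disjoint from all members of the family. -/
theorem exists_le_finrank_eq_disjoint {K V : Type*} [Field K] [Infinite K]
    [AddCommGroup V] [Module K V] [FiniteDimensional K V] (U : Submodule K V)
    (s : Finset (Submodule K V)) {m : ℕ}
    (hs : ∀ W ∈ s, Module.finrank K ↥(U ⊓ W) ≤ m) (d : ℕ) (hd : d + m ≤ Module.finrank K U) :
    ∃ U' ≤ U, Module.finrank K U' = d ∧ ∀ W ∈ s, Disjoint U' W := by
  classical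
  induction d with
  | zero => exact ⟨⊥, bot_le, finrank_bot K V, fun W _ => disjoint_bot_left⟩
  | succ d ih =>
    obtain ⟨U', hle, hdim, hdis⟩ := ih (by omega)
    obtain ⟨v, hvU, hv⟩ := exists_mem_forall_notMem_of_not_le U
      (insert U' (s.image fun W => U' ⊔ U ⊓ W)) (by
        intro P hP hUP
        have hfin := Submodule.finrank_mono hUP
        rcases Finset.mem_insert.1 hP with rfl | hP
        · omega
        · obtain ⟨W, hW, rfl⟩ := Finset.mem_image.1 hP
          have := Submodule.finrank_add_le_finrank_add_finrank U' (U ⊓ W)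
          have := hs W hW
          omega)
    have hvU' : v ∉ U' := hv U' (Finset.mem_insert_self _ _)
    have hv0 : v ≠ 0 := fun h0 => hvU' (h0 ▸ U'.zero_mem)
    have hspan : K ∙ v ≤ U := (Submodule.span_singleton_le_iff_mem v U).2 hvU
    refine ⟨(K ∙ v) ⊔ U', sup_le hspan hle, ?_, fun W hW => ?_⟩
    · have hsum := Submodule.finrank_sup_add_finrank_inf_eq (K ∙ v) U'
      rw [((Submodule.disjoint_span_singleton' hv0).2 hvU').symm.eq_bot, finrank_bot,
        finrank_span_singleton hv0, hdim] at hsum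
      omega
    · have hvW : v ∉ U' ⊔ U ⊓ W :=
        hv _ (Finset.mem_insert_of_mem (Finset.mem_image_of_mem _ hW))
      have hdisj : Disjoint ((K ∙ v) ⊔ U') (U ⊓ W) :=
        Disjoint.disjoint_sup_left_of_disjoint_sup_right
          ((hdis W hW).mono_right inf_le_right)
          ((Submodule.disjoint_span_singleton' hv0).2 hvW).symm
      rw [disjoint_iff, ← inf_assoc, inf_eq_left.2 (sup_le hspan hle)] at hdisj
      exact disjoint_iff.2 hdisj

/-- Let `U` be a subspace of `ℝ^t` with `dim U = ℓ`, let `𝒲` be a finite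
collection of subspaces of `ℝ^t`, and let `ℓ' ≤ ℓ` satisfy `dim (U ⊓ W) ≤ ℓ'` for every
`W ∈ 𝒲`. Then there is a subspace `U' ≤ U` with `dim U' = ℓ - ℓ'` such that
`dim (U' ⊓ W) = 0` for every `W ∈ 𝒲`. -/
theorem stmt0 (t ℓ ℓ' : ℕ) (U : Submodule ℝ (Fin t → ℝ))
    (hU : Module.finrank ℝ U = ℓ)
    (𝒲 : Finset (Submodule ℝ (Fin t → ℝ)))
    (hℓ' : ℓ' ≤ ℓ)
    (h : ∀ W ∈ 𝒲, Module.finrank ℝ ↥(U ⊓ W) ≤ ℓ') :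
    ∃ U' : Submodule ℝ (Fin t → ℝ), U' ≤ U ∧ Module.finrank ℝ U' = ℓ - ℓ' ∧
      ∀ W ∈ 𝒲, Module.finrank ℝ ↥(U' ⊓ W) = 0 := by
  obtain ⟨U', hle, hdim, hdis⟩ := exists_le_finrank_eq_disjoint U 𝒲 h (ℓ - ℓ') (by omega)
  refine ⟨U', hle, hdim, fun W hW => ?_⟩
  rw [(hdis W hW).eq_bot, finrank_bot]
end

section
/- Let U be a linear subspace of ℝ^t with dim(U) = ℓ, and let 𝒲 be a finite collection of linear subspaces of U. Then for every natural number ℓ' ≤ ℓ there exists a linear subspace U' of U with dim(U') = ℓ' such that for every W ∈ 𝒲 it holds that dim(U' ∩ W) = max(0, dim(W) + ℓ' − ℓ). -/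
section

variable {K V : Type*} [Field K] [AddCommGroup V] [Module K V]

/-- A finite set of proper subspaces of `U` does not cover `U`. -/
theorem Submodule.exists_mem_forall_notMem_of_finset_lt [Infinite K] (U : Submodule K V)
    (s : Finset (Submodule K V)) (hs : ∀ p ∈ s, p < U) :
    ∃ v ∈ U, ∀ p ∈ s, v ∉ p := by
  classical
  have htop : ⊤ ∉ s.image (Submodule.comap U.subtype) := by
    intro h
    obtain ⟨p, hp, hpt⟩ := Finset.mem_image.mp h
    exact (hs p hp).not_ge (Submodule.comap_subtype_eq_top.mp hpt)
  obtain ⟨v, hv⟩ := (Set.ne_univ_iff_exists_notMem _).mp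
    (Subspace.biUnion_ne_univ_of_top_notMem htop)
  refine ⟨v, v.2, fun p hp hvp ↦ hv ?_⟩
  exact Set.mem_biUnion (Finset.mem_coe.mpr (Finset.mem_image_of_mem _ hp)) hvp

/-- Over an infinite field, `U` has a subspace whose sum with every member `W` of a given finite
set of subspaces of `U` has dimension `min (dim U) (dim W + k)`. -/
theorem Submodule.exists_le_forall_finrank_sup_eq [Infinite K] [FiniteDimensional K V]
    (U : Submodule K V) (s : Finset (Submodule K V)) (hs : ∀ W ∈ s, W ≤ U) (k : ℕ) :
    ∃ U' ≤ U, ∀ W ∈ s,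
      Module.finrank K ↥(U' ⊔ W) = min (Module.finrank K U) (Module.finrank K W + k) := by
  classical
  induction k with
  | zero =>
    refine ⟨⊥, bot_le, fun W hW ↦ ?_⟩
    have := Submodule.finrank_mono (hs W hW)
    rw [bot_sup_eq]
    omega
  | succ k ih =>
    obtain ⟨U', hU', h⟩ := ih
    obtain ⟨v, hvU, hv⟩ := U.exists_mem_forall_notMem_of_finset_lt
      ((s.image (U' ⊔ ·)).filter (· < U)) (fun p hp ↦ (Finset.mem_filter.mp hp).2)
    have hvU' : K ∙ v ≤ U := (Submodule.span_singleton_le_iff_mem v U).mpr hvU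
    refine ⟨U' ⊔ K ∙ v, sup_le hU' hvU', fun W hW ↦ ?_⟩
    have hle : U' ⊔ W ≤ U := sup_le hU' (hs W hW)
    have hk := h W hW
    rw [sup_right_comm]
    rcases hle.eq_or_lt with heq | hlt
    · rw [heq] at hk
      rw [heq, sup_eq_left.mpr hvU']
      omega
    · have hvW := hv _ (Finset.mem_filter.mpr ⟨Finset.mem_image_of_mem _ hW, hlt⟩)
      have := Submodule.finrank_lt_finrank_of_lt hlt
      rw [Submodule.finrank_sup_span_singleton hvW]
      omega

end

/-- Let `U` be a subspace of `ℝ^t` with `dim U = ℓ`, and let `𝒲` be a finite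
collection of subspaces of `U`. Then for every `ℓ' ≤ ℓ` there exists a subspace `U' ≤ U`
with `dim U' = ℓ'` such that `dim (U' ⊓ W) = max (0, dim W + ℓ' - ℓ)` for every `W ∈ 𝒲`. -/
theorem stmt1 (t ℓ ℓ' : ℕ) (U : Submodule ℝ (Fin t → ℝ))
    (hU : Module.finrank ℝ U = ℓ)
    (𝒲 : Finset (Submodule ℝ (Fin t → ℝ)))
    (h𝒲 : ∀ W ∈ 𝒲, W ≤ U)
    (hℓ' : ℓ' ≤ ℓ) :
    ∃ U' : Submodule ℝ (Fin t → ℝ), U' ≤ U ∧ Module.finrank ℝ U' = ℓ' ∧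
      ∀ W ∈ 𝒲, (Module.finrank ℝ ↥(U' ⊓ W) : ℤ) =
        max 0 ((Module.finrank ℝ W : ℤ) + ℓ' - ℓ) := by
  classical
  obtain ⟨U', hle, h⟩ := U.exists_le_forall_finrank_sup_eq (insert ⊥ 𝒲)
    (Finset.forall_mem_insert _ _ _ |>.mpr ⟨bot_le, h𝒲⟩) ℓ'
  have hdim := h ⊥ (Finset.mem_insert_self _ _)
  rw [sup_bot_eq, finrank_bot, hU] at hdim
  refine ⟨U', hle, by omega, fun W hW ↦ ?_⟩
  have hsup := h W (Finset.mem_insert_of_mem hW)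
  have hadd := Submodule.finrank_sup_add_finrank_inf_eq U' W
  omega
end

section
/- Let G be a simple graph on the vertex set {1,...,n} and let M be an n×n integer matrix such that M_{i,i} = 1 for every i ∈ {1,...,n} and M_{i,j} = 0 for every pair of distinct vertices i, j that are non-adjacent in G. Then for every finite field F, minrank_F(G) ≤ rank_ℝ(M), where rank_ℝ(M) is the rank over ℝ of M viewed as a real matrix. -/
/-- `M` represents the graph `G` over a field: all diagonal entries are nonzero and the entries
corresponding to distinct non-adjacent pairs of vertices vanish. -/
def RepresentsGraph {V F : Type*} [Field F] (M : Matrix V V F) (G : SimpleGraph V) : Prop :=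
  (∀ i, M i i ≠ 0) ∧ ∀ i j, i ≠ j → ¬ G.Adj i j → M i j = 0

/-- `minrank F G` is the minimum rank over `F` of a matrix representing `G` over `F`. -/
noncomputable def minrank (F : Type*) [Field F] {V : Type*} [Fintype V]
    (G : SimpleGraph V) : ℕ :=
  sInf {r : ℕ | ∃ M : Matrix V V F, RepresentsGraph M G ∧ M.rank = r}

/-- A matrix over a principal ideal domain factors through a free module of rank equal to its
rank. -/
theorem Matrix.exists_eq_mul_of_isPrincipalIdealRing {R m n : Type*} [CommRing R] [IsDomain R]
    [IsPrincipalIdealRing R] [Finite m] [Fintype n] (M : Matrix m n R) :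
    ∃ (A : Matrix m (Fin M.rank) R) (B : Matrix (Fin M.rank) n R), M = A * B := by
  classical
  have := Fintype.ofFinite m
  let b : Module.Basis (Fin M.rank) R (LinearMap.range M.mulVecLin) := Module.finBasis R _
  let c (k : n) : LinearMap.range M.mulVecLin := ⟨M.col k, Pi.single k 1, by simp⟩
  refine ⟨.of fun j i => (b i : m → R) j, .of fun i k => b.repr (c k) i, ?_⟩
  ext j k
  have h : ((∑ i, b.repr (c k) i • b i : LinearMap.range M.mulVecLin) : m → R) j = M j k := by
    rw [b.sum_repr]
    rfl
  simpa [-Module.Basis.sum_repr, Matrix.mul_apply, mul_comm] using h.symm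

/-- Extending scalars to a domain along an injective map does not decrease the rank of a matrix
over a principal ideal domain. -/
theorem Matrix.rank_le_rank_map_algebraMap {R S m n : Type*} [CommRing R] [IsDomain R]
    [IsPrincipalIdealRing R] [CommRing S] [IsDomain S] [IsNoetherianRing S] [Algebra R S]
    [FaithfulSMul R S] [Finite m] [Fintype n] (M : Matrix m n R) :
    M.rank ≤ (M.map (algebraMap R S)).rank := by
  let b : Module.Basis (Fin M.rank) R (LinearMap.range M.mulVecLin) := Module.finBasis R _
  have hb : LinearIndependent R fun i => (b i : m → R) :=
    b.linearIndependent.map' (Submodule.subtype _) (Submodule.ker_subtype _)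
  have hS : LinearIndependent S fun i => algebraMap R S ∘ (b i : m → R) :=
    linearIndependent_algebraMap_comp_iff.mpr hb
  have hmem (i) : algebraMap R S ∘ (b i : m → R) ∈
      LinearMap.range (M.map (algebraMap R S)).mulVecLin := by
    obtain ⟨c, hc⟩ := (b i).2
    refine ⟨algebraMap R S ∘ c, ?_⟩
    ext j
    rw [← hc]
    simp [RingHom.map_mulVec]
  have hr : LinearIndependent S fun i =>
      (⟨_, hmem i⟩ : LinearMap.range (M.map (algebraMap R S)).mulVecLin) :=
    LinearIndependent.of_comp (Submodule.subtype _) hS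
  exact (Fintype.card_fin _).symm.trans_le hr.fintype_card_le_finrank

/-- Mapping a matrix over a principal ideal domain along a ring homomorphism does not increase its
rank. -/
theorem Matrix.rank_map_le_of_isPrincipalIdealRing {R S m n : Type*} [CommRing R] [IsDomain R]
    [IsPrincipalIdealRing R] [CommRing S] [StrongRankCondition S] [Finite m] [Fintype n]
    (M : Matrix m n R) (f : R →+* S) : (M.map f).rank ≤ M.rank := by
  obtain ⟨A, B, h⟩ := M.exists_eq_mul_of_isPrincipalIdealRing
  calc (M.map f).rank = (A.map f * B.map f).rank := by rw [← Matrix.map_mul, ← h]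
    _ ≤ (A.map f).rank := Matrix.rank_mul_le_left _ _
    _ ≤ M.rank := (Matrix.rank_le_card_width _).trans_eq (Fintype.card_fin _)

/-- Let `G` be a graph on `n` vertices and `M` an `n × n` integer matrix with
unit diagonal whose entries at distinct non-adjacent pairs vanish. Then for every finite field
`F`, `minrank_F(G)` is at most the rank of `M` over `ℝ`. -/
theorem stmt10 (n : ℕ) (G : SimpleGraph (Fin n)) (M : Matrix (Fin n) (Fin n) ℤ)
    (hdiag : ∀ i, M i i = 1)
    (hoff : ∀ i j, i ≠ j → ¬ G.Adj i j → M i j = 0)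
    (F : Type) [Field F] [Fintype F] :
    minrank F G ≤ (M.map (Int.cast : ℤ → ℝ)).rank := by
  have hM : RepresentsGraph (M.map (Int.castRingHom F)) G :=
    ⟨fun i => by simp [hdiag], fun i j hij h => by simp [hoff i j hij h]⟩
  calc minrank F G ≤ (M.map (Int.castRingHom F)).rank := Nat.sInf_le ⟨_, hM, rfl⟩
    _ ≤ M.rank := M.rank_map_le_of_isPrincipalIdealRing _
    _ ≤ (M.map (Int.cast : ℤ → ℝ)).rank := M.rank_le_rank_map_algebraMap (S := ℝ)
end

section
/- For every odd integer ℓ ≥ 3 there exists δ = δ(ℓ) > 0 such that for every sufficiently large integer n there exists a simple graph G on n vertices containing no cycle of odd length at most ℓ, such that for every finite field F there is a symmetric n×n matrix over F representing G whose rank over F is at most n^{1−δ} (in particular, minrank_F(G) ≤ n^{1−δ} for every finite field F). -/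
open Finset in
/-- The Chu–Vandermonde expansion of an integer-valued polynomial in the binomial basis. -/
lemma ring_choose_sub_eq_sum (x m k : ℕ) :
    Ring.choose ((x : ℤ) - (m + 1)) k =
      ∑ j ∈ range (k + 1), (x.choose j : ℤ) * Ring.choose (-((m : ℤ) + 1)) (k - j) := by
  rw [sub_eq_add_neg, Ring.add_choose_eq k (Commute.all _ _),
    Nat.sum_antidiagonal_eq_sum_range_succ_mk]
  simp [Ring.choose_natCast]

open Finset in
lemma sum_subtype_card_lt_subset {α R : Type*} [Fintype α] [DecidableEq α] [CommRing R]
    (A B : Finset α) (K : ℕ) (c : ℕ → R) :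
    (∑ U : {U : Finset α // U.card < K},
      (if U.1 ⊆ A then (1 : R) else 0) * c U.1.card * (if U.1 ⊆ B then 1 else 0)) =
      ∑ j ∈ range K, ((A ∩ B).card.choose j : R) * c j := by
  have h1 : (∑ U : {U : Finset α // U.card < K},
      (if U.1 ⊆ A then (1 : R) else 0) * c U.1.card * (if U.1 ⊆ B then 1 else 0)) =
      ∑ U ∈ (univ : Finset (Finset α)).filter (fun U => U.card < K),
        (if U ⊆ A then (1 : R) else 0) * c U.card * (if U ⊆ B then 1 else 0) :=
    (Finset.sum_subtype _ (by simp)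
      (fun U : Finset α => (if U ⊆ A then (1 : R) else 0) * c U.card *
        (if U ⊆ B then 1 else 0))).symm
  have h2 : ∑ U ∈ (univ : Finset (Finset α)).filter (fun U => U.card < K),
        (if U ⊆ A then (1 : R) else 0) * c U.card * (if U ⊆ B then 1 else 0) =
      ∑ U ∈ (A ∩ B).powerset, if U.card < K then c U.card else 0 := by
    have : (A ∩ B).powerset = univ.filter (fun U => U ⊆ A ∩ B) := by
      ext U
      rw [mem_powerset, mem_filter_univ]
    rw [this, sum_filter, sum_filter]
    refine sum_congr rfl fun U _ => ?_
    by_cases hA : U ⊆ A <;> by_cases hB : U ⊆ B <;> simp [hA, hB, subset_inter_iff]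
  rw [h1, h2, sum_powerset_apply_card (fun j => if j < K then c j else 0)]
  simp only [nsmul_eq_mul, mul_ite, mul_zero]
  rw [← sum_filter]
  refine sum_subset (fun j hj => mem_range.2 (mem_filter.1 hj).2) fun j hj hj' => ?_
  have : (A ∩ B).card < j := by
    simp only [mem_filter, mem_range] at hj hj'
    omega
  simp [Nat.choose_eq_zero_of_lt this]

open Finset in
lemma card_subtype_card_lt (N K : ℕ) :
    Fintype.card {U : Finset (Fin N) // U.card < K} = ∑ j ∈ range K, N.choose j := by
  rw [Fintype.card_subtype, card_eq_sum_card_fiberwise (f := card) (t := range K)]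
  · refine sum_congr rfl fun j hj => ?_
    rw [filter_filter]
    have : (univ.filter fun U : Finset (Fin N) => U.card < K ∧ U.card = j) =
        powersetCard j univ := by
      ext U
      simp only [mem_range] at hj
      simp only [mem_filter, mem_univ, true_and, mem_powersetCard, subset_univ]
      omega
    rw [this, card_powersetCard, card_univ, Fintype.card_fin]
  · intro U hU
    simpa using hU

open Finset in
/-- The matrix whose entries are a polynomial of degree at most `k` in the intersection sizes
of a set family has rank at most the number of sets of size at most `k`. -/
lemma exists_isSymm_matrix_choose_inter {V : Type*} [Fintype V] {N : ℕ}
    (f : V → Finset (Fin N)) (m k : ℕ) (F : Type*) [Field F] :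
    ∃ M : Matrix V V F, M.IsSymm ∧
      (∀ i j, M i j = (Ring.choose (((f i ∩ f j).card : ℤ) - (m + 1)) k : ℤ)) ∧
      M.rank ≤ ∑ j ∈ range (k + 1), N.choose j := by
  classical
  let c : ℕ → F := fun j => (Ring.choose (-((m : ℤ) + 1)) (k - j) : ℤ)
  let P : Matrix V {U : Finset (Fin N) // U.card < k + 1} F :=
    Matrix.of fun i U => if U.1 ⊆ f i then 1 else 0
  let Q : Matrix {U : Finset (Fin N) // U.card < k + 1} V F :=
    Matrix.of fun U i => c U.1.card * if U.1 ⊆ f i then 1 else 0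
  have hM : ∀ i j, (P * Q) i j = (Ring.choose (((f i ∩ f j).card : ℤ) - (m + 1)) k : ℤ) := by
    intro i j
    rw [ring_choose_sub_eq_sum]
    push_cast
    rw [← sum_subtype_card_lt_subset (f i) (f j) (k + 1) c, Matrix.mul_apply]
    simp only [P, Q, Matrix.of_apply, mul_assoc]
  refine ⟨P * Q, ?_, hM, ?_⟩
  · ext i j
    rw [Matrix.transpose_apply, hM, hM, inter_comm]
  · rw [← card_subtype_card_lt]
    exact (Matrix.rank_mul_le_left P Q).trans P.rank_le_card_width

open Finset in
/-- Along a walk in a generalized Kneser graph on `s`-subsets of a `2 * s`-set, the endpoints stay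
close to equal at even distance and close to disjoint at odd distance. -/
lemma card_sdiff_le_and_card_inter_le_of_walk {V : Type*} {G : SimpleGraph V} {s m : ℕ}
    (f : V → Finset (Fin (2 * s))) (hf : ∀ v, (f v).card = s)
    (hG : ∀ u v, G.Adj u v → (f u ∩ f v).card ≤ m) {u v : V} (w : G.Walk u v) :
    (Even w.length → (f v \ f u).card ≤ w.length * m) ∧
      (Odd w.length → (f v ∩ f u).card ≤ w.length * m) := by
  induction w with
  | nil => simp
  | @cons u u' v h w ih =>
    have hm := hG _ _ h
    rw [SimpleGraph.Walk.length_cons, Nat.even_add_one, Nat.odd_add_one, Nat.not_even_iff_odd,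
      Nat.not_odd_iff_even, add_mul, one_mul]
    constructor
    · intro ho
      have h1 := ih.2 ho
      have h2 : f v \ f u ⊆ (f v ∩ f u') ∪ (f u ∪ f u')ᶜ := by
        intro a; simp; tauto
      have h3 := (card_le_card h2).trans (card_union_le _ _)
      have h4 := card_union_add_card_inter (f u) (f u')
      have h5 := card_compl_add_card (f u ∪ f u')
      rw [Fintype.card_fin] at h5
      rw [hf, hf] at h4
      omega
    · intro he
      have h1 := ih.1 he
      have h2 : f v ∩ f u ⊆ (f v \ f u') ∪ (f u ∩ f u') := by
        intro a; simp; tauto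
      have h3 := (card_le_card h2).trans (card_union_le _ _)
      omega

open Finset in
/-- A Chernoff-type bound for partial sums of binomial coefficients. -/
lemma sum_choose_mul_pow_le (N K : ℕ) {x : ℝ} (hx0 : 0 < x) (hx1 : x ≤ 1) :
    (∑ j ∈ range K, (N.choose j : ℝ)) * x ^ K ≤ (1 + x) ^ N := by
  rw [add_comm, add_pow, sum_mul]
  simp only [one_pow, mul_one]
  calc ∑ j ∈ range K, (N.choose j : ℝ) * x ^ K
      ≤ ∑ j ∈ range K, x ^ j * N.choose j := by
        refine sum_le_sum fun j hj => ?_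
        rw [mul_comm]
        exact mul_le_mul_of_nonneg_right
          (pow_le_pow_of_le_one hx0.le hx1 (mem_range.1 hj).le) (by positivity)
    _ ≤ ∑ j ∈ range (max K (N + 1)), x ^ j * N.choose j :=
        sum_le_sum_of_subset_of_nonneg (range_mono (le_max_left _ _))
          fun _ _ _ => by positivity
    _ = ∑ j ∈ range (N + 1), x ^ j * N.choose j := by
        refine (sum_subset (range_mono (le_max_right _ _)) fun j _ hj => ?_).symm
        rw [Nat.choose_eq_zero_of_lt (by simpa using hj)]
        simp

lemma one_add_sq_pow_mul_self_le {L : ℕ} (hL : 2 ≤ L) {x : ℝ} (hx : x = 1 - 1 / L) :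
    ((1 + x) ^ 2) ^ L * x ≤ (4 : ℝ) ^ L * Real.exp (-(1 / (4 * L))) ^ 2 * x ^ L := by
  have hL' : (2 : ℝ) ≤ L := by exact_mod_cast hL
  have hL0 : (0 : ℝ) < L := by linarith
  set t : ℝ := 1 / L with ht
  have ht0 : 0 < t := by positivity
  have ht2 : t ≤ 1 / 2 := by rw [ht]; gcongr
  have hx0 : 0 < x := by linarith
  have hLt : (L : ℝ) * t = 1 := by rw [ht]; field_simp
  have h1 : (1 + x) ^ 2 ≤ 4 * Real.exp (t ^ 2 / 2) * x := by
    have := Real.add_one_le_exp (t ^ 2 / 2)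
    have h : (1 + x) ^ 2 ≤ 4 * (t ^ 2 / 2 + 1) * x := by rw [hx]; nlinarith [sq_nonneg t]
    nlinarith
  have h2 : x ≤ Real.exp (-t) := by
    have := Real.add_one_le_exp (-t)
    linarith
  calc ((1 + x) ^ 2) ^ L * x ≤ (4 * Real.exp (t ^ 2 / 2) * x) ^ L * Real.exp (-t) := by
        gcongr
    _ = 4 ^ L * (Real.exp (t ^ 2 / 2) ^ L * Real.exp (-t)) * x ^ L := by
        rw [mul_pow, mul_pow]; ring
    _ = 4 ^ L * Real.exp (-(1 / (4 * L))) ^ 2 * x ^ L := by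
        rw [← Real.exp_nat_mul, ← Real.exp_nat_mul, ← Real.exp_add]
        congr 3
        have : (1 : ℝ) / (4 * L) = t / 4 := by rw [ht]; field_simp
        rw [this]
        push_cast
        linear_combination (t / 2) * hLt

open Finset in
lemma sum_choose_le_pow {L : ℕ} (hL : 2 ≤ L) (m : ℕ) :
    (∑ j ∈ range (L * m - m), ((2 * (L * m)).choose j : ℝ)) ≤
      ((4 : ℝ) ^ L * Real.exp (-(1 / (4 * L))) ^ 2) ^ m := by
  have hL' : (2 : ℝ) ≤ L := by exact_mod_cast hL
  obtain ⟨x, hx⟩ : ∃ x : ℝ, x = 1 - 1 / L := ⟨_, rfl⟩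
  have ht2 : 1 / (L : ℝ) ≤ 1 / 2 := by gcongr
  have ht0 : 0 < 1 / (L : ℝ) := by positivity
  have hx0 : 0 < x := by linarith
  have h1 := sum_choose_mul_pow_le (2 * (L * m)) (L * m - m) hx0 (by linarith)
  have h2 := pow_le_pow_left₀ (by positivity) (one_add_sq_pow_mul_self_le hL hx) m
  have hm : m ≤ L * m := Nat.le_mul_of_pos_left m (by omega)
  have h3 : x ^ (L * m) = x ^ (L * m - m) * x ^ m := by rw [← pow_add]; congr 1; omega
  refine le_of_mul_le_mul_right ?_ (pow_pos hx0 (L * m))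
  calc _ = (∑ j ∈ range (L * m - m), ((2 * (L * m)).choose j : ℝ)) * x ^ (L * m - m) * x ^ m := by
        rw [h3]; ring
    _ ≤ (1 + x) ^ (2 * (L * m)) * x ^ m := by gcongr
    _ = (((1 + x) ^ 2) ^ L * x) ^ m := by rw [mul_pow, ← pow_mul, ← pow_mul]
    _ ≤ _ := h2
    _ = _ := by rw [mul_pow _ (x ^ L), ← pow_mul]

open Finset Filter Topology in
lemma exists_sum_choose_le_rpow {L : ℕ} (hL : 2 ≤ L) :
    ∃ δ : ℝ, 0 < δ ∧ ∃ m₀ : ℕ, ∀ m : ℕ, m₀ ≤ m → ∀ n : ℕ, (L * m).centralBinom ≤ n →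
      (∑ j ∈ range (L * (m + 1) - (m + 1)), ((2 * (L * (m + 1))).choose j : ℝ)) ≤
        (n : ℝ) ^ ((1 : ℝ) - δ) := by
  have hL' : (2 : ℝ) ≤ L := by exact_mod_cast hL
  set a : ℝ := (4 : ℝ) ^ L with ha
  set σ : ℝ := Real.exp (-(1 / (4 * L))) with hσ
  have ha0 : 0 < a := by positivity
  have hσ0 : 0 < σ := Real.exp_pos _
  have hσ1 : σ < 1 := by
    rw [hσ, ← Real.exp_zero, Real.exp_lt_exp, neg_lt_zero]
    positivity
  have hloga : 1 ≤ Real.log a := by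
    rw [Real.le_log_iff_exp_le ha0]
    have h4 : (4 : ℝ) ^ 1 ≤ a := pow_le_pow_right₀ (by norm_num) (by omega)
    linarith [Real.exp_one_lt_d9]
  set δ : ℝ := 1 / (4 * L) / Real.log a with hδ
  have hδ0 : 0 < δ := by positivity
  have hδ1 : δ ≤ 1 := by
    rw [hδ, div_div, div_le_one (by positivity)]
    nlinarith
  have haδ : a ^ (-δ) = σ := by
    rw [Real.rpow_def_of_pos ha0, hσ, hδ]
    congr 1
    field_simp
  refine ⟨δ, hδ0, ?_⟩
  have hlim := tendsto_self_mul_const_pow_of_lt_one hσ0.le hσ1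
  have hev := hlim.eventually (gt_mem_nhds (show 0 < 1 / (a * (2 * L)) by positivity))
  obtain ⟨m₁, hm₁⟩ := eventually_atTop.1 hev
  refine ⟨m₁ + 1, fun m hm n hn => ?_⟩
  have hmσ := (hm₁ m (by omega)).le
  rw [le_div_iff₀ (by positivity)] at hmσ
  have hm0 : (1 : ℝ) ≤ m := by exact_mod_cast (by omega : 1 ≤ m)
  have hb : a ^ m ≤ (2 * L * m) * n := by
    have h := Nat.four_pow_le_two_mul_self_mul_centralBinom (L * m)
      (Nat.mul_pos (by omega) (by omega))
    have h' : 4 ^ (L * m) ≤ 2 * (L * m) * n := h.trans (Nat.mul_le_mul_left _ hn)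
    rw [ha, ← pow_mul, mul_assoc 2]
    exact_mod_cast h'
  have hpow : a ^ m * σ ^ m ≤ (2 * L * m) * (n : ℝ) ^ (1 - δ) := by
    have h1 : (a ^ m) ^ (1 - δ) = a ^ m * σ ^ m := by
      rw [sub_eq_add_neg, Real.rpow_add (by positivity), Real.rpow_one, ← haδ,
        ← Real.rpow_natCast, ← Real.rpow_natCast, ← Real.rpow_mul ha0.le, ← Real.rpow_mul ha0.le,
        mul_comm (m : ℝ) (-δ)]
    have hc : (1 : ℝ) ≤ 2 * L * m := by nlinarith
    calc a ^ m * σ ^ m = (a ^ m) ^ (1 - δ) := h1.symm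
      _ ≤ ((2 * L * m) * n) ^ (1 - δ) :=
          Real.rpow_le_rpow (by positivity) hb (by linarith)
      _ = (2 * L * m) ^ (1 - δ) * (n : ℝ) ^ (1 - δ) :=
          Real.mul_rpow (by positivity) (by positivity)
      _ ≤ (2 * L * m) * (n : ℝ) ^ (1 - δ) := by
          gcongr
          exact (Real.rpow_le_rpow_of_exponent_le hc (by linarith)).trans_eq (Real.rpow_one _)
  refine (sum_choose_le_pow hL (m + 1)).trans ?_
  refine le_of_mul_le_mul_left ?_ (show (0 : ℝ) < 2 * L * m by positivity)
  calc (2 * L * m) * (a * σ ^ 2) ^ (m + 1)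
      = (m * σ ^ m * (a * (2 * L))) * (a ^ m * σ ^ m) * σ ^ 2 := by ring
    _ ≤ 1 * (a ^ m * σ ^ m) * 1 := by
        gcongr
        exact pow_le_one₀ hσ0.le hσ1.le
    _ ≤ _ := by linarith

/-- For every odd `ℓ ≥ 3` there exists `δ > 0` such that for every
sufficiently large `n` there is an `n`-vertex graph `G` with no cycle of odd length at most
`ℓ`, such that for every finite field `F` there is a symmetric matrix representing `G` over `F`
of rank at most `n^{1−δ}`; in particular `minrank_F(G) ≤ n^{1−δ}` for every finite field `F`. -/
theorem stmt12 (ℓ : ℕ) (hℓ : 3 ≤ ℓ) (hodd : Odd ℓ) :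
    ∃ δ : ℝ, 0 < δ ∧ ∃ n₀ : ℕ, ∀ n : ℕ, n₀ ≤ n →
      ∃ G : SimpleGraph (Fin n),
        (∀ (v : Fin n) (w : G.Walk v v), w.IsCycle → Odd w.length → ¬ w.length ≤ ℓ) ∧
        ∀ (F : Type) [Field F] [Fintype F],
          (∃ M : Matrix (Fin n) (Fin n) F, RepresentsGraph M G ∧ M.IsSymm ∧
            (M.rank : ℝ) ≤ (n : ℝ) ^ ((1 : ℝ) - δ)) ∧
          (minrank F G : ℝ) ≤ (n : ℝ) ^ ((1 : ℝ) - δ) := by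
  have hL : 2 ≤ ℓ + 1 := by omega
  obtain ⟨δ, hδ, m₀, hm₀⟩ := exists_sum_choose_le_rpow hL
  refine ⟨δ, hδ, ((ℓ + 1) * (m₀ + 1)).centralBinom + 1, fun n hn => ?_⟩
  have hmono := Nat.centralBinom_strictMono
  have hex : ∃ m, n ≤ ((ℓ + 1) * (m + 1)).centralBinom :=
    ⟨n, ((Nat.le_succ n).trans (Nat.le_mul_of_pos_left _ (by omega))).trans (hmono.le_apply)⟩
  classical
  obtain ⟨m, hnm, hmm₀, hmn⟩ : ∃ m, n ≤ ((ℓ + 1) * (m + 1)).centralBinom ∧ m₀ ≤ m ∧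
      ((ℓ + 1) * m).centralBinom ≤ n := by
    have hspec := Nat.find_spec hex
    have hlt : m₀ < Nat.find hex := by
      by_contra! hle
      have := hmono.monotone (Nat.mul_le_mul_left (ℓ + 1) (Nat.succ_le_succ hle))
      simp only [Nat.succ_eq_add_one] at this
      omega
    refine ⟨Nat.find hex, hspec, hlt.le, ?_⟩
    obtain ⟨p, hp⟩ : ∃ p, Nat.find hex = p + 1 := ⟨Nat.find hex - 1, by omega⟩
    have := Nat.find_min hex (m := p) (by omega)
    rw [hp]
    omega
  set s := (ℓ + 1) * (m + 1) with hs
  have hsm : ℓ * (m + 1) + (m + 1) = s := by rw [hs]; ring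
  obtain ⟨f, hfinj, hfcard⟩ : ∃ f : Fin n → Finset (Fin (2 * s)), Function.Injective f ∧
      ∀ i, (f i).card = s := by
    have hcard : Fintype.card (Fin n) ≤
        Fintype.card {U : Finset (Fin (2 * s)) // U.card = s} := by
      rw [Fintype.card_finset_len, Fintype.card_fin, Fintype.card_fin,
        ← Nat.centralBinom_eq_two_mul_choose]
      exact hnm
    obtain ⟨e⟩ := Function.Embedding.nonempty_of_card_le hcard
    exact ⟨fun i => (e i).1, Subtype.val_injective.comp e.injective, fun i => (e i).2⟩
  let G : SimpleGraph (Fin n) :=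
    { Adj := fun i j => (f i ∩ f j).card ≤ m + 1
      symm := ⟨fun i j h => by rwa [Finset.inter_comm]⟩
      loopless := ⟨fun i h => by
        rw [Finset.inter_self, hfcard] at h
        nlinarith⟩ }
  refine ⟨G, fun v w _ hw hle => ?_, fun F _ _ => ?_⟩
  · have h := (card_sdiff_le_and_card_inter_le_of_walk (G := G) f hfcard (fun _ _ h => h) w).2 hw
    rw [Finset.inter_self, hfcard] at h
    have := Nat.mul_le_mul_right (m + 1) hle
    omega
  · have hk : s - (m + 1) - 1 + 1 = s - (m + 1) := by
      have : 1 * 1 ≤ ℓ * (m + 1) := Nat.mul_le_mul (by omega) (by omega)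
      omega
    obtain ⟨M, hsymm, hentry, hrank⟩ :=
      exists_isSymm_matrix_choose_inter f (m + 1) (s - (m + 1) - 1) F
    have hrep : RepresentsGraph M G := by
      refine ⟨fun i => ?_, fun i j hij hadj => ?_⟩
      · rw [hentry, Finset.inter_self, hfcard]
        have : (s : ℤ) - ((m + 1 : ℕ) + 1) = (s - (m + 1) - 1 : ℕ) := by omega
        rw [this, Ring.choose_natCast]
        simp
      · have h1 : m + 1 < (f i ∩ f j).card := not_le.1 hadj
        have h2 : (f i ∩ f j).card < s := by
          refine lt_of_le_of_ne ((Finset.card_le_card Finset.inter_subset_left).trans_eq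
            (hfcard i)) fun h => hij (hfinj ?_)
          have hi := Finset.eq_of_subset_of_card_le (Finset.inter_subset_left (s₁ := f i)
            (s₂ := f j)) (by rw [h, hfcard])
          have hj := Finset.eq_of_subset_of_card_le (Finset.inter_subset_right (s₁ := f i)
            (s₂ := f j)) (by rw [h, hfcard])
          exact hi.symm.trans hj
        have : ((f i ∩ f j).card : ℤ) - ((m + 1 : ℕ) + 1) =
            ((f i ∩ f j).card - (m + 1) - 1 : ℕ) := by omega
        rw [hentry, this, Ring.choose_natCast, Nat.choose_eq_zero_of_lt (by omega)]
        simp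
    have hle : (M.rank : ℝ) ≤ (n : ℝ) ^ ((1 : ℝ) - δ) := by
      refine le_trans ?_ (hm₀ m hmm₀ n hmn)
      rw [hk] at hrank
      exact_mod_cast hrank
    have hmin : minrank F G ≤ M.rank := Nat.sInf_le ⟨M, hrep, rfl⟩
    exact ⟨⟨M, hrep, hsymm, hle⟩, le_trans (by exact_mod_cast hmin) hle⟩
end

section
/- There exists a constant δ > 0 such that for every sufficiently large integer n there exists a triangle-free simple graph G on n vertices with od(Ḡ, F_2) ≤ n^{1−δ}, where Ḡ is the complement of G and F_2 is the field with two elements. -/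
/-- `graphOD F G` is the orthogonality dimension `od(G, F)`: the smallest `t` for which one
can assign to every vertex `v` a vector `u_v ∈ F^t` with `⟨u_v, u_v⟩ ≠ 0` (standard bilinear
form) such that `⟨u_v, u_w⟩ = 0` whenever `v` and `w` are adjacent. -/
noncomputable def graphOD (F : Type*) [Field F] {V : Type*} (G : SimpleGraph V) : ℕ :=
  sInf {t : ℕ | ∃ u : V → Fin t → F,
    (∀ v, ∑ i, u v i * u v i ≠ 0) ∧
    ∀ v w, G.Adj v w → ∑ i, u v i * u w i = 0}

open Finset

theorem graphOD_le_card {F : Type*} [Field F] {V : Type*} (G : SimpleGraph V)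
    {ι : Type*} [Fintype ι] (u : V → ι → F) (hself : ∀ v, ∑ i, u v i * u v i ≠ 0)
    (hadj : ∀ v w, G.Adj v w → ∑ i, u v i * u w i = 0) : graphOD F G ≤ Fintype.card ι := by
  refine Nat.sInf_le ⟨fun v i => u v ((Fintype.equivFin ι).symm i), fun v => ?_, fun v w h => ?_⟩
  · rw [Equiv.sum_comp (Fintype.equivFin ι).symm (fun i => u v i * u v i)]
    exact hself v
  · rw [Equiv.sum_comp (Fintype.equivFin ι).symm (fun i => u v i * u w i)]
    exact hadj v w h

/-- The number of blocks `n / |V| + 1` suffices to cover `n` vertices by disjoint copies of `H`. -/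
theorem exists_cliqueFree_graphOD_compl_le {F : Type*} [Field F] {V : Type*} [Fintype V]
    [Nonempty V] {H : SimpleGraph V} (hH : H.CliqueFree 3) {ι : Type*} [Fintype ι]
    (u : V → ι → F) (hself : ∀ v, ∑ i, u v i * u v i ≠ 0)
    (hadj : ∀ v w, Hᶜ.Adj v w → ∑ i, u v i * u w i = 0) (n : ℕ) :
    ∃ G : SimpleGraph (Fin n), G.CliqueFree 3 ∧
      graphOD F Gᶜ ≤ (n / Fintype.card V + 1) * Fintype.card ι := by
  classical
  have hcard : Fintype.card (Fin n) ≤ Fintype.card (Fin (n / Fintype.card V + 1) × V) := by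
    simp only [Fintype.card_fin, Fintype.card_prod]
    have := (Nat.lt_div_mul_add (a := n) (Fintype.card_pos (α := V))).le
    linarith
  obtain ⟨e⟩ := Function.Embedding.nonempty_of_card_le hcard
  let G : SimpleGraph (Fin n) :=
    { Adj := fun v w => (e v).1 = (e w).1 ∧ H.Adj (e v).2 (e w).2
      symm := ⟨fun v w h => ⟨h.1.symm, h.2.symm⟩⟩
      loopless := ⟨fun v h => H.loopless.irrefl _ h.2⟩ }
  have hG : G.CliqueFree 3 := by
    intro t ht
    obtain ⟨a, b, c, hab, hac, hbc, -⟩ := SimpleGraph.is3Clique_iff.mp ht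
    exact hH _ (SimpleGraph.is3Clique_triple_iff.mpr ⟨hab.2, hac.2, hbc.2⟩)
  refine ⟨G, hG, ?_⟩
  let u' : Fin n → Fin (n / Fintype.card V + 1) × ι → F :=
    fun v x => if (e v).1 = x.1 then u (e v).2 x.2 else 0
  have hprod (v w) : ∑ x, u' v x * u' w x =
      if (e v).1 = (e w).1 then ∑ i, u (e v).2 i * u (e w).2 i else 0 := by
    rw [Fintype.sum_prod_type, Finset.sum_eq_single (e v).1]
    · by_cases h : (e v).1 = (e w).1
      · simp [u', h]
      · simp [u', h, Ne.symm h]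
    · intro b _ hb
      simp [u', Ne.symm hb]
    · simp
  have := graphOD_le_card Gᶜ u' (fun v => ?_) (fun v w h => ?_)
  · simpa using this
  · simpa [hprod] using hself _
  · rw [hprod]
    split_ifs with h1
    · refine hadj _ _ ⟨fun h2 => h.1 (e.injective (Prod.ext h1 h2)), fun h2 => h.2 ⟨h1, h2⟩⟩
    · rfl

theorem odd_choose_two_pow_sub_one_iff (r x : ℕ) :
    Odd (x.choose (2 ^ r - 1)) ↔ 2 ^ r ∣ x + 1 := by
  induction r generalizing x with
  | zero => simp
  | succ r ih =>
    have hpos : 0 < 2 ^ r := by positivity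
    have hmod : (2 ^ (r + 1) - 1) % 2 = 1 := by rw [pow_succ]; omega
    have hdiv : (2 ^ (r + 1) - 1) / 2 = 2 ^ r - 1 := by rw [pow_succ]; omega
    have key : x.choose (2 ^ (r + 1) - 1) ≡
        (x % 2).choose 1 * (x / 2).choose (2 ^ r - 1) [MOD 2] := by
      have := Choose.choose_modEq_choose_mod_mul_choose_div_nat
        (n := x) (k := 2 ^ (r + 1) - 1) (p := 2)
      rwa [hmod, hdiv] at this
    rw [Nat.odd_iff, key, ← Nat.odd_iff, Nat.choose_one_right, Nat.odd_mul, ih]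
    constructor
    · rintro ⟨h1, h2⟩
      rw [Nat.odd_iff] at h1
      have : x + 1 = (x / 2 + 1) * 2 := by omega
      rw [this, pow_succ]
      exact Nat.mul_dvd_mul_right h2 2
    · intro h
      have h2 : 2 ∣ x + 1 := (Dvd.intro_left (2 ^ r) (pow_succ 2 r).symm).trans h
      have : x + 1 = (x / 2 + 1) * 2 := by omega
      rw [this, pow_succ] at h
      exact ⟨by rw [Nat.odd_iff]; omega, Nat.dvd_of_mul_dvd_mul_right two_pos h⟩

/-- The generalized Kneser graph on the `s`-subsets of `Fin d`, two of them being adjacent when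
they are distinct and their intersection has at most `s - q` elements. -/
def lowIntersectionGraph (d s q : ℕ) : SimpleGraph {A : Finset (Fin d) // #A = s} where
  Adj A B := A ≠ B ∧ #(A.1 ∩ B.1) + q ≤ s
  symm := ⟨fun A B h => ⟨h.1.symm, by rw [inter_comm]; exact h.2⟩⟩
  loopless := ⟨fun _ h => h.1 rfl⟩

theorem lowIntersectionGraph_cliqueFree {d s q : ℕ} (hd : d < 3 * q) :
    (lowIntersectionGraph d s q).CliqueFree 3 := by
  intro t ht
  obtain ⟨A, B, C, hAB, hAC, hBC, -⟩ := SimpleGraph.is3Clique_iff.mp ht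
  have h1 := card_union_add_card_inter A.1 B.1
  have h2 := card_union_add_card_inter (A.1 ∪ B.1) C.1
  have h3 : #((A.1 ∪ B.1) ∩ C.1) ≤ #(A.1 ∩ C.1) + #(B.1 ∩ C.1) := by
    rw [union_inter_distrib_right]
    exact card_union_le _ _
  have h4 := card_finset_fin_le (A.1 ∪ B.1 ∪ C.1)
  have := hAB.2
  have := hAC.2
  have := hBC.2
  have := A.2
  have := B.2
  have := C.2
  omega

/-- The coordinates of `A` indexed by the sets `T` with at most `k` elements, chosen so that the
inner product of two such vectors is `(|A ∩ B| + c).choose k` modulo `2`. -/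
def subsetVector {d : ℕ} (c k : ℕ) (A : Finset (Fin d)) (T : {T : Finset (Fin d) // #T ≤ k}) :
    ZMod 2 :=
  if T.1 ⊆ A then (c.choose (k - #T.1) : ZMod 2) else 0

theorem sum_powerset_choose {α : Type*} (c k : ℕ) (S : Finset α) :
    ∑ T ∈ S.powerset, (if #T ≤ k then c.choose (k - #T) else 0) = (#S + c).choose k := by
  rw [sum_powerset_apply_card (fun j => if j ≤ k then c.choose (k - j) else 0),
    Nat.add_choose_eq, Nat.sum_antidiagonal_eq_sum_range_succ_mk]
  have h1 : range (#S + 1) ⊆ range (#S + k + 1) := range_subset_range.mpr (by omega)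
  have h2 : range (k + 1) ⊆ range (#S + k + 1) := range_subset_range.mpr (by omega)
  rw [sum_subset h1, ← sum_subset h2 (f := fun j =>
    (#S).choose j • if j ≤ k then c.choose (k - j) else 0)]
  · refine sum_congr rfl fun j hj => ?_
    rw [if_pos (by simpa [Nat.lt_succ_iff] using hj), smul_eq_mul]
  · intro j _ hj
    rw [if_neg (by simpa using hj), smul_zero]
  · intro j _ hj
    rw [Nat.choose_eq_zero_of_lt (by simpa using hj), zero_smul]

theorem sum_subsetVector_mul {d : ℕ} (c k : ℕ) (A B : Finset (Fin d)) :
    ∑ T, subsetVector c k A T * subsetVector c k B T = ((#(A ∩ B) + c).choose k : ZMod 2) := by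
  have hsq : ∀ x : ZMod 2, x * x = x := by decide
  rw [← sum_powerset_choose, Nat.cast_sum, ← sum_filter_add_sum_filter_not _ (fun T => #T ≤ k),
    sum_eq_zero (s := filter (fun T => ¬ #T ≤ k) _), add_zero]
  · have h (T : {T : Finset (Fin d) // #T ≤ k}) : subsetVector c k A T * subsetVector c k B T =
        if T.1 ⊆ A ∩ B then (c.choose (k - #T.1) : ZMod 2) else 0 := by
      by_cases hA : T.1 ⊆ A <;> by_cases hB : T.1 ⊆ B <;>
        simp [subsetVector, hA, hB, subset_inter_iff, hsq]
    simp_rw [h]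
    rw [← sum_subtype (univ.filter fun T : Finset (Fin d) => #T ≤ k) (by simp)
      (fun T => if T ⊆ A ∩ B then (c.choose (k - #T) : ZMod 2) else 0), ← sum_filter]
    refine sum_congr ?_ fun T hT => ?_
    · ext T
      simp only [mem_filter, mem_powerset, mem_univ, true_and, and_comm]
    · rw [if_pos (mem_filter.mp hT).2]
  · intro T hT
    rw [if_neg (mem_filter.mp hT).2, Nat.cast_zero]

theorem subsetVector_self_ne_zero {d h r : ℕ} (hr : 2 ^ r = 2 * h)
    (A : {A : Finset (Fin d) // #A = 3 * h}) :
    ∑ T, subsetVector (h - 1) (2 ^ r - 1) A.1 T * subsetVector (h - 1) (2 ^ r - 1) A.1 T ≠ 0 := by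
  have hpos : 0 < 2 ^ r := by positivity
  rw [sum_subsetVector_mul, inter_self, A.2, ZMod.natCast_ne_zero_iff_odd,
    odd_choose_two_pow_sub_one_iff]
  exact ⟨2, by omega⟩

theorem subsetVector_orthogonal {d h r : ℕ} (hr : 2 ^ r = 2 * h)
    (A B : {A : Finset (Fin d) // #A = 3 * h})
    (hAB : (lowIntersectionGraph d (3 * h) (2 ^ r))ᶜ.Adj A B) :
    ∑ T, subsetVector (h - 1) (2 ^ r - 1) A.1 T * subsetVector (h - 1) (2 ^ r - 1) B.1 T = 0 := by
  have hpos : 0 < 2 ^ r := by positivity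
  have hne : A ≠ B := hAB.1
  have hlow : 3 * h < #(A.1 ∩ B.1) + 2 ^ r := by
    by_contra! hle
    exact hAB.2 ⟨hne, hle⟩
  have hup : #(A.1 ∩ B.1) < 3 * h := by
    refine lt_of_le_of_ne ((card_le_card inter_subset_left).trans_eq A.2) fun heq => hne ?_
    have hA := eq_of_subset_of_card_le (inter_subset_left (s₁ := A.1) (s₂ := B.1))
      (by rw [heq, A.2])
    have hB := eq_of_subset_of_card_le (inter_subset_right (s₁ := A.1) (s₂ := B.1))
      (by rw [heq, B.2])
    exact Subtype.ext (hA.symm.trans hB)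
  rw [sum_subsetVector_mul, ZMod.natCast_eq_zero_iff_even, ← Nat.not_odd_iff_even,
    odd_choose_two_pow_sub_one_iff]
  rintro ⟨m, hm⟩
  have h1 : 2 ^ r * 1 < 2 ^ r * m := by omega
  have h2 : 2 ^ r * m < 2 ^ r * 2 := by omega
  have := Nat.lt_of_mul_lt_mul_left h1
  have := Nat.lt_of_mul_lt_mul_left h2
  omega

theorem card_subsets_card_le_mul_le {d k : ℕ} :
    Fintype.card {T : Finset (Fin d) // #T ≤ k} * 2 ^ (d - k) ≤ 3 ^ d := by
  have h := sum_pow_mul_eq_add_pow (1 : ℕ) 2 (univ : Finset (Fin d))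
  simp only [one_pow, one_mul, card_univ, Fintype.card_fin, powerset_univ] at h
  rw [Fintype.card_subtype, ← smul_eq_mul, ← h]
  refine (card_nsmul_le_sum _ _ _ fun T hT => ?_).trans
    (sum_le_sum_of_subset (filter_subset (fun T => #T ≤ k) _))
  exact Nat.pow_le_pow_right two_pos (Nat.sub_le_sub_left (mem_filter.mp hT).2 d)

theorem four_pow_lt_mul_choose {m : ℕ} (hm : 4 ≤ m) :
    4 ^ m < 2 * m * (2 * m - 1).choose m := by
  obtain ⟨e, rfl⟩ : ∃ e, m = e + 1 := ⟨m - 1, by omega⟩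
  have h := Nat.four_pow_lt_mul_centralBinom (e + 1) hm
  have h2 : Nat.centralBinom (e + 1) = 2 * (2 * (e + 1) - 1).choose (e + 1) := by
    rw [Nat.centralBinom_eq_two_mul_choose, show 2 * (e + 1) = (2 * e + 1) + 1 by ring,
      Nat.choose_succ_succ, Nat.add_sub_cancel, Nat.choose_symm_half]
    ring
  rw [h2] at h
  linarith

/-- The construction for `n` vertices, with the parameter `q = 2 ^ r`. -/
theorem exists_cliqueFree_graphOD_le_of_two_pow {r n : ℕ} (hr : 2 ≤ r) (hn : 8 ^ 2 ^ r ≤ n) :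
    ∃ G : SimpleGraph (Fin n), G.CliqueFree 3 ∧
      (graphOD (ZMod 2) Gᶜ : ℝ) ≤ n * (6 * (2 ^ r : ℕ) * (27 / 32) ^ 2 ^ r) := by
  obtain ⟨h, hrh⟩ : ∃ h, 2 ^ r = 2 * h := dvd_pow_self 2 (by omega)
  have hh : 2 ≤ h := by
    have : 2 ^ 2 ≤ 2 ^ r := Nat.pow_le_pow_right two_pos hr
    omega
  set V := {A : Finset (Fin (2 * (3 * h) - 1)) // #A = 3 * h}
  set ι := {T : Finset (Fin (2 * (3 * h) - 1)) // #T ≤ 2 ^ r - 1}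
  have hV : Fintype.card V = (2 * (3 * h) - 1).choose (3 * h) := by
    simp [V]
  have hVlow : 8 ^ 2 ^ r < 3 * 2 ^ r * Fintype.card V := by
    have := four_pow_lt_mul_choose (m := 3 * h) (by omega)
    rw [hV]
    convert this using 1
    · rw [hrh, pow_mul, pow_mul]; norm_num
    · rw [hrh]; ring
  have hVpos : 0 < Fintype.card V := by
    by_contra! h0
    simp [Nat.le_zero.mp h0] at hVlow
  have hVup : Fintype.card V ≤ n := by
    refine le_trans ?_ hn
    rw [hV]
    calc _ ≤ 2 ^ (2 * (3 * h) - 1) := Nat.choose_le_two_pow _ _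
      _ ≤ 2 ^ (3 * 2 ^ r) := Nat.pow_le_pow_right two_pos (by omega)
      _ = _ := by rw [pow_mul]; norm_num
  have hι : Fintype.card ι * 4 ^ 2 ^ r ≤ 27 ^ 2 ^ r := by
    calc _ = Fintype.card ι * 2 ^ ((2 * (3 * h) - 1) - (2 ^ r - 1)) := by
          rw [show (2 * (3 * h) - 1) - (2 ^ r - 1) = 2 * 2 ^ r by omega, pow_mul]; norm_num
      _ ≤ 3 ^ (2 * (3 * h) - 1) := card_subsets_card_le_mul_le
      _ ≤ 3 ^ (3 * 2 ^ r) := Nat.pow_le_pow_right (by norm_num) (by omega)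
      _ = _ := by rw [pow_mul]; norm_num
  have : Nonempty V := Fintype.card_pos_iff.mp hVpos
  obtain ⟨G, hG, hod⟩ := exists_cliqueFree_graphOD_compl_le
    (lowIntersectionGraph_cliqueFree (d := 2 * (3 * h) - 1) (s := 3 * h) (q := 2 ^ r) (by omega))
    (fun A => subsetVector (h - 1) (2 ^ r - 1) A.1) (subsetVector_self_ne_zero hrh)
    (subsetVector_orthogonal hrh) n
  refine ⟨G, hG, ?_⟩
  have hblocks : (n / Fintype.card V + 1) * Fintype.card V ≤ 2 * n := by
    have := Nat.div_mul_le_self n (Fintype.card V)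
    linarith
  change graphOD (ZMod 2) Gᶜ ≤ (n / Fintype.card V + 1) * Fintype.card ι at hod
  generalize Fintype.card V = N at hod hblocks hVlow hVpos
  generalize Fintype.card ι = D at hod hι
  generalize 2 ^ r = q at hι hVlow ⊢
  have hod' : (graphOD (ZMod 2) Gᶜ : ℝ) ≤
      ((n / N + 1 : ℕ) : ℝ) * D := by exact_mod_cast hod
  have hblocks' : ((n / N + 1 : ℕ) : ℝ) * N ≤ 2 * n := by
    exact_mod_cast hblocks
  have hVlow' : (8 : ℝ) ^ q ≤ 3 * q * N := by exact_mod_cast hVlow.le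
  have hι' : (D : ℝ) * 4 ^ q ≤ 27 ^ q := by exact_mod_cast hι
  generalize ((n / N + 1 : ℕ) : ℝ) = M at hod' hblocks'
  refine hod'.trans ?_
  have hVpos' : (0 : ℝ) < N := by exact_mod_cast hVpos
  have hM : M * 8 ^ q ≤ 6 * n * q := by
    have hM' : M ≤ 2 * n / N := by rwa [le_div_iff₀ hVpos']
    calc M * 8 ^ q ≤ 2 * n / N * (3 * q * N) := by gcongr
      _ = 6 * n * q := by field_simp; ring
  have h32 : (27 / 32 : ℝ) ^ q = 27 ^ q / (8 ^ q * 4 ^ q) := by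
    rw [← mul_pow, ← div_pow]; norm_num
  rw [h32, ← mul_div_assoc, ← mul_div_assoc, le_div_iff₀ (by positivity)]
  calc M * D * (8 ^ q * 4 ^ q) = (M * 8 ^ q) * (D * 4 ^ q) := by ring
    _ ≤ (6 * n * q) * 27 ^ q := by gcongr
    _ = _ := by ring

theorem rpow_one_div_sixty_le {n q : ℕ} (hn : n ≤ 64 ^ q) :
    (n : ℝ) ^ (1 / 60 : ℝ) ≤ (10 / 9) ^ q := by
  have h64 : (64 : ℝ) ^ (1 / 60 : ℝ) ≤ 10 / 9 := by
    rw [one_div, Real.rpow_inv_le_iff_of_pos (by norm_num) (by norm_num) (by norm_num)]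
    norm_num
  calc (n : ℝ) ^ (1 / 60 : ℝ) ≤ ((64 : ℝ) ^ q) ^ (1 / 60 : ℝ) :=
        Real.rpow_le_rpow (by positivity) (by exact_mod_cast hn) (by norm_num)
    _ = ((64 : ℝ) ^ (1 / 60 : ℝ)) ^ q := by
        rw [← Real.rpow_natCast, ← Real.rpow_mul (by norm_num), mul_comm,
          Real.rpow_mul (by norm_num), Real.rpow_natCast]
    _ ≤ (10 / 9) ^ q := by gcongr

theorem exists_forall_ge_mul_pow_le_one :
    ∃ Q : ℕ, ∀ q : ℕ, Q ≤ q → 6 * (q : ℝ) * (15 / 16) ^ q ≤ 1 := by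
  have h := (tendsto_self_mul_const_pow_of_lt_one (r := (15 / 16 : ℝ))
    (by norm_num) (by norm_num)).const_mul 6
  rw [mul_zero] at h
  obtain ⟨Q, hQ⟩ := Filter.eventually_atTop.mp (h.eventually_le_const one_pos)
  exact ⟨Q, fun q hq => by simpa [mul_assoc] using hQ q hq⟩

/-- There is a constant `δ > 0` such that for every sufficiently large `n`
there exists a triangle-free `n`-vertex graph `G` with `od(Ḡ, F_2) ≤ n^{1−δ}`. -/
theorem stmt13 :
    ∃ δ : ℝ, 0 < δ ∧ ∃ n₀ : ℕ, ∀ n : ℕ, n₀ ≤ n →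
      ∃ G : SimpleGraph (Fin n), G.CliqueFree 3 ∧
        (graphOD (ZMod 2) Gᶜ : ℝ) ≤ (n : ℝ) ^ ((1 : ℝ) - δ) := by
  obtain ⟨Q, hQ⟩ := exists_forall_ge_mul_pow_le_one
  refine ⟨1 / 60, by norm_num, 8 ^ 2 ^ (Q + 2), fun n hn => ?_⟩
  have hn0 : n ≠ 0 := (lt_of_lt_of_le (by positivity) hn).ne'
  set L := Nat.log 8 n
  set r := Nat.log 2 L
  have hL : 2 ^ (Q + 2) ≤ L := (Nat.le_log_iff_pow_le (by norm_num) hn0).mpr hn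
  have hL0 : L ≠ 0 := (lt_of_lt_of_le (by positivity) hL).ne'
  have hr : Q + 2 ≤ r := (Nat.le_log_iff_pow_le (by norm_num) hL0).mpr hL
  have hlow : 8 ^ 2 ^ r ≤ n :=
    (Nat.pow_le_pow_right (by norm_num) (Nat.pow_log_le_self 2 hL0)).trans
      (Nat.pow_log_le_self 8 hn0)
  have hup : n ≤ 64 ^ 2 ^ r := by
    have h1 : n < 8 ^ (L + 1) := Nat.lt_pow_succ_log_self (by norm_num) n
    have h2 : L < 2 ^ (r + 1) := Nat.lt_pow_succ_log_self (by norm_num) L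
    calc n ≤ 8 ^ (L + 1) := h1.le
      _ ≤ 8 ^ (2 * 2 ^ r) := Nat.pow_le_pow_right (by norm_num) (by rw [pow_succ] at h2; omega)
      _ = 64 ^ 2 ^ r := by rw [pow_mul]; norm_num
  obtain ⟨G, hG, hod⟩ := exists_cliqueFree_graphOD_le_of_two_pow (by omega : 2 ≤ r) hlow
  refine ⟨G, hG, hod.trans ?_⟩
  have hroot := rpow_one_div_sixty_le hup
  have hsmall := hQ (2 ^ r) (by have := Nat.lt_two_pow_self (n := r); omega)
  have hnpos : (0 : ℝ) < n := by exact_mod_cast Nat.pos_of_ne_zero hn0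
  rw [Real.rpow_sub hnpos, Real.rpow_one, le_div_iff₀ (by positivity), mul_assoc]
  refine mul_le_of_le_one_right hnpos.le (le_trans ?_ hsmall)
  calc _ ≤ 6 * ((2 ^ r : ℕ) : ℝ) * (27 / 32) ^ 2 ^ r * (10 / 9) ^ 2 ^ r := by gcongr
    _ = 6 * ((2 ^ r : ℕ) : ℝ) * (15 / 16) ^ 2 ^ r := by
        rw [mul_assoc, ← mul_pow]; norm_num
end

section
/- There exists a constant δ > 0 such that for infinitely many integers m there exists a finite set S of vectors in F_2^m with |S| ≥ m^{1+δ} such that every v ∈ S satisfies ⟨v, v⟩ ≠ 0, and among any three distinct vectors of S there are two that are orthogonal to each other. -/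
open Finset

/-- The coefficient of `x.choose j` in the expansion of `(x - t).choose (3 * t)`, modulo `2`. -/
noncomputable def shiftCoeff (t j : ℕ) : ZMod 2 :=
  ((Ring.choose (-(t : ℤ)) (3 * t - j) : ℤ) : ZMod 2)

lemma sum_shiftCoeff_mul_choose {t x : ℕ} (hx : t ≤ x) :
    ∑ j ∈ range (3 * t + 1), shiftCoeff t j * (x.choose j : ZMod 2) =
      ((x - t).choose (3 * t) : ZMod 2) := by
  have h := Ring.add_choose_eq (3 * t) (Commute.all (x : ℤ) (-(t : ℤ)))
  rw [Finset.Nat.sum_antidiagonal_eq_sum_range_succ_mk, ← sub_eq_add_neg, ← Nat.cast_sub hx,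
    Ring.choose_natCast] at h
  have h' := congrArg (Int.cast : ℤ → ZMod 2) h
  push_cast at h'
  rw [h']
  refine sum_congr rfl fun j _ => ?_
  rw [Ring.choose_natCast, mul_comm]
  simp [shiftCoeff]

lemma shiftCoeff_self (t : ℕ) : shiftCoeff t (3 * t) = 1 := by
  simp [shiftCoeff]

/-- The subsets of an `8t`-element set having at most `3t` elements. -/
abbrev SmallSubset (t : ℕ) : Type := {T : Finset (Fin (8 * t)) // T.card ≤ 3 * t}

/-- The weighted incidence vector of the small subsets of `A`. -/
noncomputable def incidenceVec (t : ℕ) (A : Finset (Fin (8 * t))) (T : SmallSubset t) : ZMod 2 :=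
  if T.1 ⊆ A then shiftCoeff t T.1.card else 0

lemma zmod_two_mul_self (a : ZMod 2) : a * a = a := by
  revert a; decide

lemma sum_incidenceVec_mul (t : ℕ) (A B : Finset (Fin (8 * t))) :
    ∑ T, incidenceVec t A T * incidenceVec t B T =
      ∑ j ∈ range (3 * t + 1), shiftCoeff t j * ((A ∩ B).card.choose j : ZMod 2) := by
  have h1 : ∀ T : SmallSubset t, incidenceVec t A T * incidenceVec t B T =
      if T.1 ⊆ A ∩ B then shiftCoeff t T.1.card else 0 := by
    intro T
    by_cases hA : T.1 ⊆ A <;> by_cases hB : T.1 ⊆ B <;>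
      simp [incidenceVec, subset_inter_iff, hA, hB, zmod_two_mul_self]
  simp_rw [h1]
  rw [← Finset.sum_subtype (univ.filter fun T : Finset (Fin (8 * t)) => T.card ≤ 3 * t)
    (by simp) (fun T => if T ⊆ A ∩ B then shiftCoeff t T.card else 0), ← sum_filter,
    ← sum_fiberwise_of_maps_to (t := range (3 * t + 1)) (g := Finset.card)
      (by intro T hT; simp at hT ⊢; omega)]
  refine sum_congr rfl fun j hj => ?_
  have hset : ((univ.filter fun T : Finset (Fin (8 * t)) => T.card ≤ 3 * t).filter
      (· ⊆ A ∩ B)).filter (fun T => T.card = j) = (A ∩ B).powersetCard j := by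
    ext T
    simp only [mem_filter, mem_univ, true_and, mem_powersetCard]
    have := mem_range.1 hj
    constructor
    · rintro ⟨⟨-, h⟩, h'⟩
      exact ⟨h, h'⟩
    · rintro ⟨h, h'⟩
      exact ⟨⟨by omega, h⟩, h'⟩
  rw [hset, sum_congr rfl (g := fun _ => shiftCoeff t j)
    (fun T hT => by rw [(mem_powersetCard.1 hT).2]), sum_const, card_powersetCard, nsmul_eq_mul,
    mul_comm]

lemma sum_incidenceVec_mul_self {t : ℕ} {A : Finset (Fin (8 * t))} (hA : A.card = 4 * t) :
    ∑ T, incidenceVec t A T * incidenceVec t A T = 1 := by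
  rw [sum_incidenceVec_mul, inter_self, hA, sum_shiftCoeff_mul_choose (by omega),
    show 4 * t - t = 3 * t by omega, Nat.choose_self, Nat.cast_one]

lemma card_inter_lt_of_card_eq {α : Type*} [DecidableEq α] {A B : Finset α}
    (h : A.card = B.card) (hne : A ≠ B) : (A ∩ B).card < A.card := by
  refine card_lt_card (inter_subset_left.ssubset_of_ne fun hAB => hne ?_)
  exact eq_of_subset_of_card_le (inter_eq_left.1 hAB) h.ge

lemma sum_incidenceVec_mul_eq_zero {t : ℕ} {A B : Finset (Fin (8 * t))} (hA : A.card = 4 * t)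
    (hB : B.card = 4 * t) (hne : A ≠ B) (h : t ≤ (A ∩ B).card) :
    ∑ T, incidenceVec t A T * incidenceVec t B T = 0 := by
  have := card_inter_lt_of_card_eq (hA.trans hB.symm) hne
  rw [sum_incidenceVec_mul, sum_shiftCoeff_mul_choose h,
    Nat.choose_eq_zero_of_lt (by omega), Nat.cast_zero]

lemma incidenceVec_injOn {t : ℕ} (ht : 0 < t) :
    Set.InjOn (incidenceVec t) {A | A.card = 4 * t} := by
  intro A hA B hB hAB
  by_contra hne
  rw [Set.mem_ofPred_eq] at hA hB
  have hnot : ¬ A ⊆ B := fun h => hne (eq_of_subset_of_card_le h (by omega))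
  obtain ⟨a, haA, haB⟩ := not_subset.1 hnot
  obtain ⟨T, haT, hTA, hT⟩ := exists_subsuperset_card_eq (singleton_subset_iff.2 haA)
    (n := 3 * t) (by simp; omega) (by omega)
  have hTB : ¬ T ⊆ B := fun h => haB (h (singleton_subset_iff.1 haT))
  have := congrFun hAB ⟨T, hT.le⟩
  simp [incidenceVec, hTA, hTB, hT, shiftCoeff_self] at this

lemma exists_le_card_inter {t : ℕ} {A B C : Finset (Fin (8 * t))}
    (hA : A.card = 4 * t) (hB : B.card = 4 * t) (hC : C.card = 4 * t) :
    t ≤ (A ∩ B).card ∨ t ≤ (A ∩ C).card ∨ t ≤ (B ∩ C).card := by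
  by_contra! h
  have h1 := card_union_add_card_inter A B
  have h2 := card_union_add_card_inter (A ∪ B) C
  have h3 : ((A ∪ B) ∩ C).card ≤ (A ∩ C).card + (B ∩ C).card := by
    rw [union_inter_distrib_right]
    exact card_union_le _ _
  have h4 := card_le_univ (A ∪ B ∪ C)
  rw [Fintype.card_fin] at h4
  omega

lemma card_smallSubset_le (t : ℕ) : Fintype.card (SmallSubset t) ≤ 199 ^ t := by
  have hsum := sum_pow_mul_eq_add_pow (3 : ℕ) 5 (univ : Finset (Fin (8 * t)))
  rw [card_univ, Fintype.card_fin, powerset_univ] at hsum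
  have hle : Fintype.card (SmallSubset t) * (3 ^ (3 * t) * 5 ^ (5 * t)) ≤ (3 + 5) ^ (8 * t) := by
    rw [← hsum, Fintype.card_subtype, ← smul_eq_mul]
    refine (card_nsmul_le_sum _ (fun T => 3 ^ T.card * 5 ^ (8 * t - T.card)) _ ?_).trans
      (sum_le_sum_of_subset (filter_subset _ _))
    intro T hT
    obtain ⟨k, hk⟩ := Nat.exists_eq_add_of_le (mem_filter.1 hT).2
    rw [hk, show 8 * t - T.card = 5 * t + k by omega, pow_add, pow_add]
    have : 3 ^ k ≤ 5 ^ k := Nat.pow_le_pow_left (by norm_num) k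
    calc _ = 3 ^ T.card * 5 ^ (5 * t) * 3 ^ k := by ring
      _ ≤ 3 ^ T.card * 5 ^ (5 * t) * 5 ^ k := Nat.mul_le_mul_left _ this
      _ = _ := by ring
  rw [pow_mul, pow_mul, pow_mul, ← mul_pow] at hle
  have hpos : 0 < ((3 ^ 3 * 5 ^ 5) ^ t : ℕ) := by positivity
  refine Nat.le_of_mul_le_mul_right (hle.trans ?_) hpos
  rw [← mul_pow]
  exact Nat.pow_le_pow_left (by norm_num) t

lemma le_card_smallSubset {t : ℕ} (ht : 0 < t) : t ≤ Fintype.card (SmallSubset t) := by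
  have h := Fintype.card_le_of_injective
    (fun i : Fin (8 * t) => (⟨{i}, by rw [card_singleton]; omega⟩ : SmallSubset t))
    (fun i j hij => singleton_injective (Subtype.ext_iff.1 hij))
  rw [Fintype.card_fin] at h
  exact (by omega : t ≤ 8 * t).trans h

lemma four_mul_mul_pow_le {t : ℕ} (ht : 20 ≤ t) : 4 * t * 200 ^ t ≤ 256 ^ t := by
  induction t, ht using Nat.le_induction with
  | base => norm_num
  | succ n hn ih =>
    calc 4 * (n + 1) * 200 ^ (n + 1) = (200 * (n + 1)) * (4 * 200 ^ n) := by ring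
      _ ≤ (256 * n) * (4 * 200 ^ n) := Nat.mul_le_mul_right _ (by omega)
      _ = 256 * (4 * n * 200 ^ n) := by ring
      _ ≤ 256 * 256 ^ n := Nat.mul_le_mul_left _ ih
      _ = 256 ^ (n + 1) := by ring

lemma pow_le_choose {t : ℕ} (ht : 20 ≤ t) : 200 ^ t ≤ (8 * t).choose (4 * t) := by
  have h := Nat.four_pow_lt_mul_centralBinom (4 * t) (by omega)
  rw [Nat.centralBinom, ← mul_assoc, pow_mul] at h
  exact Nat.le_of_mul_le_mul_left ((four_mul_mul_pow_le ht).trans h.le) (by omega)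


/-- There is a constant `δ > 0` such that for infinitely many integers `m`
there is a set `S` of at least `m^{1+δ}` vectors in `F_2^m`, each non-self-orthogonal with
respect to the standard bilinear form, such that among any three distinct vectors of `S`
two are orthogonal. -/
theorem stmt14 :
    ∃ δ : ℝ, 0 < δ ∧ ∀ N : ℕ, ∃ m : ℕ, N ≤ m ∧
      ∃ S : Finset (Fin m → ZMod 2),
        (m : ℝ) ^ ((1 : ℝ) + δ) ≤ (S.card : ℝ) ∧
        (∀ v ∈ S, ∑ i, v i * v i ≠ 0) ∧
        ∀ u ∈ S, ∀ v ∈ S, ∀ w ∈ S, u ≠ v → u ≠ w → v ≠ w →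
          (∑ i, u i * v i = 0 ∨ ∑ i, u i * w i = 0 ∨ ∑ i, v i * w i = 0) := by
  have hlog : 0 < Real.log 199 := Real.log_pos (by norm_num)
  have hpow : (199 : ℝ) ^ (Real.log 200 / Real.log 199) = 200 := by
    rw [Real.rpow_def_of_pos (by norm_num), mul_div_cancel₀ _ hlog.ne',
      Real.exp_log (by norm_num)]
  refine ⟨Real.log 200 / Real.log 199 - 1, ?_, fun N => ?_⟩
  · rw [sub_pos, one_lt_div hlog]
    exact Real.log_lt_log (by norm_num) (by norm_num)
  obtain ⟨t, hNt, ht⟩ : ∃ t, N ≤ t ∧ 20 ≤ t := ⟨max N 20, le_max_left _ _, le_max_right _ _⟩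
  have ht0 : 0 < t := by omega
  let e : Fin (Fintype.card (SmallSubset t)) ≃ SmallSubset t := (Fintype.equivFin _).symm
  have hsum : ∀ A B, ∑ i, (incidenceVec t A ∘ e) i * (incidenceVec t B ∘ e) i =
      ∑ T, incidenceVec t A T * incidenceVec t B T := fun A B =>
    e.sum_comp fun T => incidenceVec t A T * incidenceVec t B T
  refine ⟨Fintype.card (SmallSubset t), hNt.trans (le_card_smallSubset ht0),
    (powersetCard (4 * t) univ).image fun A => incidenceVec t A ∘ e, ?_, ?_, ?_⟩
  · rw [card_image_of_injOn, card_powersetCard, card_univ, Fintype.card_fin,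
      add_sub_cancel]
    · calc (Fintype.card (SmallSubset t) : ℝ) ^ (Real.log 200 / Real.log 199)
          ≤ ((199 : ℝ) ^ t) ^ (Real.log 200 / Real.log 199) := by
            refine Real.rpow_le_rpow (by positivity) (mod_cast card_smallSubset_le t) ?_
            exact div_nonneg (Real.log_nonneg (by norm_num)) hlog.le
        _ = 200 ^ t := by
            rw [← Real.rpow_natCast, ← Real.rpow_mul (by norm_num), mul_comm,
              Real.rpow_mul (by norm_num), hpow, Real.rpow_natCast]
        _ ≤ _ := mod_cast pow_le_choose ht
    · intro A hA B hB hAB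
      exact incidenceVec_injOn ht0 (mem_powersetCard.1 hA).2 (mem_powersetCard.1 hB).2
        (e.surjective.injective_comp_right hAB)
  · simp only [forall_mem_image, mem_powersetCard]
    rintro A ⟨-, hA⟩
    rw [hsum, sum_incidenceVec_mul_self hA]
    exact one_ne_zero
  · simp only [forall_mem_image, mem_powersetCard]
    rintro A ⟨-, hA⟩ B ⟨-, hB⟩ C ⟨-, hC⟩ hAB hAC hBC
    simp only [hsum]
    refine (exists_le_card_inter hA hB hC).imp (fun h => ?_) (Or.imp (fun h => ?_) fun h => ?_)
    · exact sum_incidenceVec_mul_eq_zero hA hB (fun h' => hAB (h' ▸ rfl)) h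
    · exact sum_incidenceVec_mul_eq_zero hA hC (fun h' => hAC (h' ▸ rfl)) h
    · exact sum_incidenceVec_mul_eq_zero hB hC (fun h' => hBC (h' ▸ rfl)) h
end

section
/- For every field F and every simple graph G on n vertices, minrank_F(G) · minrank_F(Ḡ) ≥ n, where Ḡ denotes the complement of G. -/
namespace Matrix

variable {F m n : Type*} [Field F] [Fintype n]

/-- Rank factorization: a matrix of rank `r` is a product with inner dimension `r`. -/
theorem exists_eq_mul_fin_rank [Finite m] (A : Matrix m n F) :
    ∃ (B : Matrix m (Fin A.rank) F) (C : Matrix (Fin A.rank) n F), A = B * C := by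
  classical
  let b : Module.Basis (Fin A.rank) F (LinearMap.range A.mulVecLin) := Module.finBasis F _
  let c : n → LinearMap.range A.mulVecLin := fun j => ⟨A.col j, Pi.single j 1, by simp⟩
  refine ⟨of fun i k => (b k : m → F) i, of fun k j => b.repr (c j) k, ?_⟩
  ext i j
  have h := congrArg (fun v : LinearMap.range A.mulVecLin => (v : m → F) i) (b.sum_repr (c j))
  simp only [AddSubmonoidClass.coe_finsetSum, Submodule.coe_smul, Finset.sum_apply,
    Pi.smul_apply, smul_eq_mul] at h
  rw [mul_apply]
  exact h.symm.trans (Finset.sum_congr rfl fun k _ => mul_comm _ _)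

/-- The rank is submultiplicative under the Hadamard product. -/
theorem rank_hadamard_le [Finite m] (A B : Matrix m n F) :
    (A.hadamard B).rank ≤ A.rank * B.rank := by
  obtain ⟨P, Q, hA⟩ := A.exists_eq_mul_fin_rank
  obtain ⟨R, S, hB⟩ := B.exists_eq_mul_fin_rank
  have h : A.hadamard B =
      (of fun i (k : Fin A.rank × Fin B.rank) => P i k.1 * R i k.2) *
        of fun (k : Fin A.rank × Fin B.rank) j => Q k.1 j * S k.2 j := by
    ext i j
    rw [hadamard_apply, congrFun₂ hA i j, congrFun₂ hB i j]
    simp only [mul_apply, of_apply, Finset.sum_mul_sum, Fintype.sum_prod_type]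
    exact Finset.sum_congr rfl fun _ _ => Finset.sum_congr rfl fun _ _ => mul_mul_mul_comm ..
  rw [h]
  exact (rank_mul_le_left _ _).trans ((rank_le_card_width _).trans_eq (by simp))

end Matrix

/-- The minrank is attained by some representing matrix. -/
theorem exists_representsGraph_rank_eq_minrank (F : Type*) [Field F] {V : Type*} [Fintype V]
    (G : SimpleGraph V) : ∃ M : Matrix V V F, RepresentsGraph M G ∧ M.rank = minrank F G := by
  classical
  exact Nat.sInf_mem (s := {r : ℕ | ∃ M : Matrix V V F, RepresentsGraph M G ∧ M.rank = r})
    ⟨_, 1, ⟨fun i => by simp, fun i j hij _ => Matrix.one_apply_ne hij⟩, rfl⟩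

/-- The Hadamard product of matrices representing a graph and its complement is diagonal with
nonzero diagonal entries, hence has full rank. -/
theorem RepresentsGraph.rank_hadamard_compl {F V : Type*} [Field F] [Fintype V]
    {G : SimpleGraph V} {M N : Matrix V V F} (hM : RepresentsGraph M G)
    (hN : RepresentsGraph N Gᶜ) : (M.hadamard N).rank = Fintype.card V := by
  classical
  have h : M.hadamard N = Matrix.diagonal fun i => M i i * N i i := by
    ext i j
    rcases eq_or_ne i j with rfl | hij
    · simp
    rw [Matrix.diagonal_apply_ne _ hij, Matrix.hadamard_apply]
    by_cases hG : G.Adj i j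
    · rw [hN.2 i j hij (by simp [hG]), mul_zero]
    · rw [hM.2 i j hij hG, zero_mul]
  rw [h]
  refine Matrix.rank_of_det_ne_zero ?_
  rw [Matrix.det_diagonal]
  exact Finset.prod_ne_zero_iff.2 fun i _ => mul_ne_zero (hM.1 i) (hN.1 i)

/-- For every field `F` and every graph `G` on `n` vertices,
`minrank_F(G) · minrank_F(Ḡ) ≥ n`. -/
theorem stmt15 (F : Type*) [Field F] (n : ℕ) (G : SimpleGraph (Fin n)) :
    n ≤ minrank F G * minrank F Gᶜ := by
  obtain ⟨M, hM, hMr⟩ := exists_representsGraph_rank_eq_minrank F G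
  obtain ⟨N, hN, hNr⟩ := exists_representsGraph_rank_eq_minrank F Gᶜ
  rw [← hMr, ← hNr]
  calc n = (M.hadamard N).rank := by rw [hM.rank_hadamard_compl hN, Fintype.card_fin]
    _ ≤ M.rank * N.rank := Matrix.rank_hadamard_le M N
end

section
/- There exists a constant δ > 0 such that for infinitely many integers n there exists a simple graph G on n vertices satisfying both of the following: (1) there exist an integer N and an assignment of a unit vector w_v ∈ ℝ^N to every vertex v of G such that ⟨w_v, w_{v'}⟩ ≤ −1/2 for every pair of adjacent vertices v, v' (i.e., the vector chromatic number of G is at most 3); and (2) minrank_F(Ḡ) ≥ n^δ for every finite field F, where Ḡ is the complement of G. -/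
open Finset in
/-- The alternating sum over the subsets of `A` of size less than `k` that avoid `B` is the indicator
of `A ⊆ B`, provided that `A \ B` has fewer than `k` elements. -/
theorem sum_neg_one_pow_card_subset_disjoint {α R : Type*} [Fintype α] [DecidableEq α]
    [CommRing R] (A B : Finset α) {k : ℕ} (h : #(A \ B) < k) :
    ∑ T : {T : Finset α // #T < k},
        (if T.1 ⊆ A then (-1 : R) ^ #T.1 else 0) * (if Disjoint T.1 B then 1 else 0) =
      if A \ B = ∅ then 1 else 0 := by
  have key : ∑ T ∈ (A \ B).powerset, (-1 : R) ^ #T = if A \ B = ∅ then 1 else 0 := by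
    have := congrArg (Int.cast : ℤ → R) (sum_powerset_neg_one_pow_card (x := A \ B))
    push_cast at this
    exact this
  rw [← key, ← Finset.sum_subtype (univ.filter fun T : Finset α => #T < k) (by simp)
    (fun T => (if T ⊆ A then (-1 : R) ^ #T else 0) * (if Disjoint T B then 1 else 0))]
  symm
  apply Finset.sum_subset_zero_on_sdiff
  · intro T hT
    rw [mem_powerset] at hT
    simpa using (card_le_card hT).trans_lt h
  · intro T hT
    simp only [mem_sdiff, mem_powerset, subset_sdiff, not_and] at hT
    by_cases hA : T ⊆ A
    · simp [hT.2 hA]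
    · simp [hA]
  · intro T hT
    rw [mem_powerset, subset_sdiff] at hT
    simp [hT.1, hT.2]

/-- A matrix of rank `r` factors through `Fin r`. -/
theorem Matrix.exists_eq_mul_of_rank {m n F : Type*} [Fintype m] [Fintype n] [Field F]
    (M : Matrix m n F) :
    ∃ (U : Matrix m (Fin M.rank) F) (W : Matrix (Fin M.rank) n F), M = U * W := by
  classical
  let b := Module.finBasis F (LinearMap.range M.mulVecLin)
  refine ⟨Matrix.of fun i a => (b a).1 i, Matrix.of fun a j =>
    b.repr ⟨M.mulVecLin (Pi.single j 1), LinearMap.mem_range_self _ _⟩ a, ?_⟩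
  ext i j
  have h := b.sum_repr ⟨M.mulVecLin (Pi.single j 1), LinearMap.mem_range_self _ _⟩
  have h' := congrFun (congrArg Subtype.val h) i
  simp only [Submodule.coe_sum, Submodule.coe_smul, Finset.sum_apply, Pi.smul_apply, smul_eq_mul,
    Matrix.mulVecLin_apply, Matrix.mulVec_single_one, Matrix.col_apply] at h'
  rw [Matrix.mul_apply, ← h']
  refine Finset.sum_congr rfl fun a _ => ?_
  simp only [Matrix.mulVecLin_apply, Matrix.mulVec_single_one]
  exact mul_comm _ _

/-- If `P * Q` represents `G`, then its inner dimension times the minrank of the complement of `G`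
is at least the number of vertices. -/
theorem card_le_minrank_compl_mul_card {V K F : Type*} [Fintype V] [Fintype K] [Field F]
    (G : SimpleGraph V) (P : Matrix V K F) (Q : Matrix K V F) (h : RepresentsGraph (P * Q) G) :
    Fintype.card V ≤ minrank F Gᶜ * Fintype.card K := by
  classical
  have hne : {r : ℕ | ∃ M : Matrix V V F, RepresentsGraph M Gᶜ ∧ M.rank = r}.Nonempty :=
    ⟨_, 1, ⟨fun i => by simp, fun i j hij _ => Matrix.one_apply_ne hij⟩, rfl⟩
  obtain ⟨M, hM, hr⟩ := Nat.sInf_mem hne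
  change M.rank = minrank F Gᶜ at hr
  obtain ⟨U, W, hUW⟩ := M.exists_eq_mul_of_rank
  let X : Matrix V (Fin M.rank × K) F := Matrix.of fun i a => U i a.1 * P i a.2
  let Y : Matrix (Fin M.rank × K) V F := Matrix.of fun a j => W a.1 j * Q a.2 j
  have hXY : X * Y = Matrix.diagonal fun i => M i i * (P * Q) i i := by
    have hprod (i j : V) : (X * Y) i j = M i j * (P * Q) i j := by
      rw [congrFun₂ hUW i j, Matrix.mul_apply, Matrix.mul_apply, Matrix.mul_apply, Finset.sum_mul_sum,
        Fintype.sum_prod_type]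
      refine Finset.sum_congr rfl fun a _ => Finset.sum_congr rfl fun k _ => ?_
      simp only [X, Y, Matrix.of_apply]
      ring
    ext i j
    rw [hprod]
    obtain rfl | hij := eq_or_ne i j
    · simp
    · rw [Matrix.diagonal_apply_ne _ hij]
      by_cases hG : G.Adj i j
      · rw [hM.2 i j hij (by simp [SimpleGraph.compl_adj, hG]), zero_mul]
      · rw [h.2 i j hij hG, mul_zero]
  have hdet : (X * Y).det ≠ 0 := by
    rw [hXY, Matrix.det_diagonal]
    exact Finset.prod_ne_zero_iff.2 fun i _ => mul_ne_zero (hM.1 i) (h.1 i)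
  calc Fintype.card V = (X * Y).rank := (Matrix.rank_of_det_ne_zero hdet).symm
    _ ≤ X.rank := Matrix.rank_mul_le_left _ _
    _ ≤ Fintype.card (Fin M.rank × K) := Matrix.rank_le_card_width _
    _ = minrank F Gᶜ * Fintype.card K := by rw [Fintype.card_prod, Fintype.card_fin, hr]

open Finset in
/-- A Chernoff-type bound on the number of subsets of size less than `k`. -/
theorem card_finset_card_lt_mul_two_pow_le (d k : ℕ) :
    Fintype.card {T : Finset (Fin d) // #T < k} * 2 ^ (d - k) ≤ 3 ^ d := by
  rw [Fintype.card_subtype, ← smul_eq_mul, ← Finset.sum_const]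
  calc ∑ _T ∈ univ.filter (fun T : Finset (Fin d) => #T < k), 2 ^ (d - k)
      ≤ ∑ T ∈ univ.filter (fun T : Finset (Fin d) => #T < k), 1 ^ #T * 2 ^ (d - #T) := by
        refine Finset.sum_le_sum fun T hT => ?_
        rw [one_pow, one_mul]
        exact Nat.pow_le_pow_right two_pos (Nat.sub_le_sub_left (mem_filter.1 hT).2.le _)
    _ ≤ ∑ T : Finset (Fin d), 1 ^ #T * 2 ^ (d - #T) :=
        Finset.sum_le_sum_of_subset (filter_subset _ _)
    _ = 3 ^ d := Fin.sum_pow_mul_eq_add_pow 1 2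

/-- The graph on an indexed family of sets in which two indices are adjacent when the corresponding
sets share at most `m` elements. -/
def smallInterGraph {V α : Type*} [DecidableEq α] (S : V → Finset α) (m : ℕ) : SimpleGraph V where
  Adj i j := i ≠ j ∧ (S i ∩ S j).card ≤ m
  symm := ⟨fun i j h => ⟨h.1.symm, by rw [Finset.inter_comm]; exact h.2⟩⟩
  loopless := ⟨fun _ h => h.1 rfl⟩

open Finset in
theorem card_le_minrank_compl_smallInterGraph_mul {V α F : Type*} [Fintype V] [Fintype α]
    [DecidableEq α] [Field F] {S : V → Finset α} (hS : Function.Injective S) {m k : ℕ}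
    (hk : 0 < k) (hcard : ∀ i, #(S i) = m + k) :
    Fintype.card V ≤ minrank F (smallInterGraph S m)ᶜ *
      Fintype.card {T : Finset α // #T < k} := by
  refine card_le_minrank_compl_mul_card _
    (Matrix.of fun i T => if T.1 ⊆ S i then (-1 : F) ^ #T.1 else 0)
    (Matrix.of fun T j => if Disjoint T.1 (S j) then 1 else 0) ⟨fun i => ?_, fun i j hij hG => ?_⟩
  · rw [Matrix.mul_apply]
    simp only [Matrix.of_apply]
    rw [sum_neg_one_pow_card_subset_disjoint _ _ (by simpa using hk)]
    simp
  · have hlt : m < #(S i ∩ S j) := by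
      by_contra hle
      exact hG ⟨hij, not_lt.1 hle⟩
    have hsum := card_sdiff_add_card_inter (S i) (S j)
    rw [hcard] at hsum
    rw [Matrix.mul_apply]
    simp only [Matrix.of_apply]
    rw [sum_neg_one_pow_card_subset_disjoint _ _ (by omega), if_neg]
    intro hempty
    exact hij (hS (eq_of_subset_of_card_le (sdiff_eq_empty_iff_subset.1 hempty)
      (by rw [hcard, hcard])))

open Finset in
/-- The inner product of the `±1` vectors of two sets. -/
theorem sum_sign_mul_sign {α : Type*} [Fintype α] [DecidableEq α] (A B : Finset α) :
    ∑ j, (if j ∈ A then (1 : ℝ) else -1) * (if j ∈ B then 1 else -1) =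
      4 * #(A ∩ B) - 2 * #A - 2 * #B + Fintype.card α := by
  have h (j : α) : (if j ∈ A then (1 : ℝ) else -1) * (if j ∈ B then 1 else -1) =
      4 * (if j ∈ A ∩ B then 1 else 0) - 2 * (if j ∈ A then 1 else 0) -
        2 * (if j ∈ B then 1 else 0) + 1 := by
    by_cases hA : j ∈ A <;> by_cases hB : j ∈ B <;> simp [hA, hB] <;> norm_num
  simp only [h, sum_add_distrib, sum_sub_distrib, ← mul_sum, sum_boole]
  simp [-mem_inter]

/-- Sets of size `4 * m` in a ground set of size `8 * m` have unit sign vectors whose inner product is at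
most `-1/2` on the edges of `smallInterGraph`. -/
theorem exists_unit_vectors_smallInterGraph {V : Type*} {m : ℕ} (hm : 0 < m)
    {S : V → Finset (Fin (8 * m))} (hcard : ∀ i, (S i).card = 4 * m) :
    ∃ w : V → Fin (8 * m) → ℝ, (∀ v, ∑ i, w v i ^ 2 = 1) ∧
      ∀ v v', (smallInterGraph S m).Adj v v' → ∑ i, w v i * w v' i ≤ -(1 / 2) := by
  have hm' : (0 : ℝ) < m := Nat.cast_pos.2 hm
  let w : V → Fin (8 * m) → ℝ := fun v i => (√(8 * m))⁻¹ * if i ∈ S v then 1 else -1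
  have hw (v v' : V) : ∑ i, w v i * w v' i = (4 * (S v ∩ S v').card - 8 * m) / (8 * m) := by
    have hsq : (√(8 * m : ℝ))⁻¹ * (√(8 * m))⁻¹ = (8 * m : ℝ)⁻¹ := by
      rw [← mul_inv, Real.mul_self_sqrt (by positivity)]
    rw [Finset.sum_congr rfl fun i _ => (mul_mul_mul_comm _ _ _ _ : w v i * w v' i = _),
      hsq, ← Finset.mul_sum, sum_sign_mul_sign, hcard, hcard, Fintype.card_fin]
    push_cast
    ring
  refine ⟨w, fun v => ?_, fun v v' h => ?_⟩
  · simp only [sq]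
    rw [hw, Finset.inter_self, hcard, div_eq_one_iff_eq (by positivity)]
    push_cast
    ring
  · have h2 : ((S v ∩ S v').card : ℝ) ≤ m := Nat.cast_le.2 h.2
    rw [hw, div_le_iff₀ (by positivity)]
    linarith

/-- Numerical estimate behind the exponent `1/80`. -/
theorem two_pow_le_of_centralBinom_le_mul {s r R : ℕ} (hs : 4 ≤ s)
    (hr : (40 * s).centralBinom ≤ r * R) (hR : R * 2 ^ (50 * s) ≤ 3 ^ (80 * s)) : 2 ^ s ≤ r := by
  have hc : 4 ^ (40 * s) ≤ 40 * s * (40 * s).centralBinom :=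
    (Nat.four_pow_lt_mul_centralBinom _ (by omega)).le
  have h40 : 40 * s ≤ 4 ^ s := by
    clear hr hR hc
    induction s, hs using Nat.le_induction with
    | base => norm_num
    | succ n hn ih => rw [pow_succ]; omega
  have h127 : 3 ^ (80 * s) ≤ 2 ^ (127 * s) := by
    rw [pow_mul, pow_mul]
    exact Nat.pow_le_pow_left (by norm_num) _
  have hmain : 2 ^ s * 2 ^ (129 * s) ≤ r * 2 ^ (129 * s) := by
    calc 2 ^ s * 2 ^ (129 * s) = 4 ^ (40 * s) * 2 ^ (50 * s) := by
          rw [show (4 : ℕ) = 2 ^ 2 by norm_num, ← pow_mul, ← pow_add, ← pow_add]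
          congr 1
          ring
      _ ≤ 4 ^ s * (r * R) * 2 ^ (50 * s) := by
          gcongr
          exact hc.trans (Nat.mul_le_mul h40 hr)
      _ = 4 ^ s * r * (R * 2 ^ (50 * s)) := by ring
      _ ≤ 4 ^ s * r * 2 ^ (127 * s) := by
          gcongr
          exact hR.trans h127
      _ = r * 2 ^ (129 * s) := by
          rw [show (4 : ℕ) = 2 ^ 2 by norm_num, ← pow_mul, mul_right_comm, mul_comm, ← pow_add]
          congr 2
          ring
  exact Nat.le_of_mul_le_mul_right hmain (by positivity)

/-- There is a constant `δ > 0` such that for infinitely many `n` there is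
an `n`-vertex graph `G` whose vector chromatic number is at most `3` (witnessed by unit
vectors `w_v` with `⟨w_v, w_{v'}⟩ ≤ −1/2` for adjacent `v, v'`), while
`minrank_F(Ḡ) ≥ n^δ` for every finite field `F`. -/
theorem stmt16 :
    ∃ δ : ℝ, 0 < δ ∧ ∀ N : ℕ, ∃ n : ℕ, N ≤ n ∧
      ∃ G : SimpleGraph (Fin n),
        (∃ (N' : ℕ) (w : Fin n → Fin N' → ℝ),
          (∀ v, ∑ i, w v i ^ 2 = 1) ∧
          ∀ v v', G.Adj v v' → ∑ i, w v i * w v' i ≤ -(1 / 2)) ∧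
        ∀ (F : Type) [Field F] [Fintype F],
          (n : ℝ) ^ δ ≤ (minrank F Gᶜ : ℝ) := by
  refine ⟨1 / 80, by norm_num, fun N => ?_⟩
  obtain ⟨s, hs⟩ : ∃ s, s = N + 4 := ⟨_, rfl⟩
  obtain ⟨m, hms⟩ : ∃ m, m = 10 * s := ⟨_, rfl⟩
  obtain ⟨n, hns⟩ : ∃ n, n = (40 * s).centralBinom := ⟨_, rfl⟩
  have hm : 0 < m := by omega
  have hn : Fintype.card {T : Finset (Fin (8 * m)) // T.card = 4 * m} = n := by
    rw [Fintype.card_finset_len, Fintype.card_fin, show 8 * m = 2 * (40 * s) by omega,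
      show 4 * m = 40 * s by omega, hns, Nat.centralBinom]
  let e := (Fintype.equivFinOfCardEq hn).symm
  let S : Fin n → Finset (Fin (8 * m)) := fun i => (e i).1
  have hS : Function.Injective S := Subtype.val_injective.comp e.injective
  have hcard (i : Fin n) : (S i).card = 4 * m := (e i).2
  refine ⟨n, ?_, smallInterGraph S m, ⟨8 * m, exists_unit_vectors_smallInterGraph hm hcard⟩,
    fun F _ _ => ?_⟩
  · have h := Nat.choose_le_centralBinom 1 (40 * s)
    rw [Nat.choose_one_right] at h
    omega
  · have h1 := card_le_minrank_compl_smallInterGraph_mul (F := F) hS (m := m) (k := 3 * m)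
      (by omega) (fun i => by rw [hcard]; ring)
    rw [Fintype.card_fin] at h1
    have h2 := card_finset_card_lt_mul_two_pow_le (8 * m) (3 * m)
    rw [show 8 * m - 3 * m = 50 * s by omega, show 3 ^ (8 * m) = 3 ^ (80 * s) by
      congr 1; omega] at h2
    have h3 : 2 ^ s ≤ minrank F (smallInterGraph S m)ᶜ :=
      two_pow_le_of_centralBinom_le_mul (by omega) (hns.symm.trans_le h1) h2
    have hn2 : n ≤ 2 ^ (80 * s) := by
      rw [hns, show 80 * s = 2 * (40 * s) by ring]
      exact Nat.choose_le_two_pow _ _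
    calc (n : ℝ) ^ (1 / 80 : ℝ) ≤ ((2 : ℝ) ^ (80 * s)) ^ (1 / 80 : ℝ) :=
          Real.rpow_le_rpow (by positivity) (by exact_mod_cast hn2) (by norm_num)
      _ = 2 ^ s := by
          rw [← Real.rpow_natCast, ← Real.rpow_mul (by norm_num), ← Real.rpow_natCast]
          congr 1
          push_cast
          ring
      _ ≤ (minrank F (smallInterGraph S m)ᶜ : ℝ) := by exact_mod_cast h3
end
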